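/- Let Ω ⊂ ℝⁿ be a smooth bounded domain with n ≥ 2, let p > 1 and r ∈ [1,∞), and assume n = p(1+r). Then there exists a constant A > 0 depending only on n and p such that for every v ∈ C^∞ on the closure of Ω with v = 0 on ∂Ω, setting I_p := ( ∫_{Ω ∩ {|∇v|>0}} |H_v|^{pr} |∇v|^p dx )^{1/p}, p' := p/(p−1), and V(s) := |{x ∈ Ω : |v(x)| > s}|, if I_p > 0 then for almost every s ∈ (0, ‖v‖_{L^∞(Ω)}) one has V(s) ≤ |Ω| · exp( −( s / (A I_p) )^{p'} ). -/

import Mathlib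

open MeasureTheory Filter Bornology
open scoped ENNReal Topology

/-- Divergence of a vector field on `ℝⁿ = EuclideanSpace ℝ (Fin n)`. -/
noncomputable def divg {n : ℕ} (V : EuclideanSpace ℝ (Fin n) → EuclideanSpace ℝ (Fin n))
    (x : EuclideanSpace ℝ (Fin n)) : ℝ :=
  ∑ i, fderiv ℝ V x (EuclideanSpace.single i 1) i

/-- `H_v(x) = -(1/(n-1)) div(∇v/|∇v|)(x)`, the mean curvature of the level set of `|v|`
through `x` (at points where `∇v(x) ≠ 0`). -/
noncomputable def meanCurv {n : ℕ} (v : EuclideanSpace ℝ (Fin n) → ℝ)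
    (x : EuclideanSpace ℝ (Fin n)) : ℝ :=
  -(1 / ((n : ℝ) - 1)) * divg (fun y => ‖gradient v y‖⁻¹ • gradient v y) x

local notation "𝔼" n => EuclideanSpace ℝ (Fin n)

section Calculus

variable {n : ℕ}

open scoped RealInnerProductSpace

theorem divg_smul {f : (𝔼 n) → ℝ} {V : (𝔼 n) → 𝔼 n} {x : 𝔼 n}
    (hf : DifferentiableAt ℝ f x) (hV : DifferentiableAt ℝ V x) :
    divg (fun y => f y • V y) x = fderiv ℝ f x (V x) + f x * divg V x := by
  have hsum : V x = ∑ i, V x i • EuclideanSpace.single i (1 : ℝ) := by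
    simpa using ((EuclideanSpace.basisFun (Fin n) ℝ).sum_repr (V x)).symm
  unfold divg
  rw [fderiv_fun_smul hf hV]
  conv_rhs => rw [hsum, map_sum]
  simp [Finset.sum_add_distrib, Finset.mul_sum, mul_comm, add_comm]

theorem divg_sub {V W : (𝔼 n) → 𝔼 n} {x : 𝔼 n}
    (hV : DifferentiableAt ℝ V x) (hW : DifferentiableAt ℝ W x) :
    divg (fun y => V y - W y) x = divg V x - divg W x := by
  unfold divg
  rw [fderiv_fun_sub hV hW]
  simp

theorem continuous_divg {V : (𝔼 n) → 𝔼 n} (hV : ContDiff ℝ 1 V) : Continuous (divg V) := by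
  unfold divg
  have := hV.continuous_fderiv one_ne_zero
  fun_prop

theorem integral_fderiv_eq_zero {f : (𝔼 n) → ℝ} (hf : ContDiff ℝ 1 f) (hc : HasCompactSupport f)
    (a : 𝔼 n) : ∫ x, fderiv ℝ f x a = 0 := by
  have hd : Differentiable ℝ f := hf.differentiable one_ne_zero
  have hcont : Continuous fun x => fderiv ℝ f x a :=
    (hf.continuous_fderiv one_ne_zero).clm_apply continuous_const
  have hc' : HasCompactSupport fun x => fderiv ℝ f x a := hc.fderiv_apply (𝕜 := ℝ) a
  have := integral_mul_fderiv_eq_neg_fderiv_mul_of_integrable (μ := volume)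
    (f := fun _ : 𝔼 n => (1 : ℝ)) (g := f) (v := a) (by simp)
    (by simpa using hcont.integrable_of_hasCompactSupport hc')
    (by simpa using hf.continuous.integrable_of_hasCompactSupport hc)
    (fun x _ => differentiableAt_const _) (fun x _ => hd x)
  simpa using this

theorem integral_divg_eq_zero {V : (𝔼 n) → 𝔼 n} (hV : ContDiff ℝ 1 V) (hc : HasCompactSupport V) :
    ∫ x, divg V x = 0 := by
  have hd : Differentiable ℝ V := hV.differentiable one_ne_zero
  have key : ∀ i : Fin n, ∀ x, fderiv ℝ V x (EuclideanSpace.single i 1) i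
      = fderiv ℝ (fun y => V y i) x (EuclideanSpace.single i 1) := by
    intro i x
    have : HasFDerivAt (fun y => V y i)
        ((EuclideanSpace.proj i : (𝔼 n) →L[ℝ] ℝ).comp (fderiv ℝ V x)) x :=
      (EuclideanSpace.proj i : (𝔼 n) →L[ℝ] ℝ).hasFDerivAt.comp x (hd x).hasFDerivAt
    rw [this.fderiv]; rfl
  have hCi : ∀ i : Fin n, ContDiff ℝ 1 fun y => V y i := fun i =>
    (EuclideanSpace.proj i : (𝔼 n) →L[ℝ] ℝ).contDiff.comp hV
  have hci : ∀ i : Fin n, HasCompactSupport fun y => V y i := fun i =>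
    hc.comp_left (g := fun z : 𝔼 n => z i) rfl
  unfold divg
  simp_rw [key]
  rw [integral_finsetSum]
  · exact Finset.sum_eq_zero fun i _ => integral_fderiv_eq_zero (hCi i) (hci i) _
  · intro i _
    exact (((hCi i).continuous_fderiv one_ne_zero).clm_apply
      continuous_const).integrable_of_hasCompactSupport ((hci i).fderiv_apply (𝕜 := ℝ) _)

end Calculus

section FirstVariation

variable {n : ℕ}

open scoped RealInnerProductSpace

theorem contDiff_gradient {v : (𝔼 n) → ℝ} (hv : ContDiff ℝ 2 v) :
    ContDiff ℝ 1 (gradient v) := by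
  have h1 : ContDiff ℝ 1 (fderiv ℝ v) := hv.fderiv_right (by norm_num)
  exact (InnerProductSpace.toDual ℝ (𝔼 n)).symm.toContinuousLinearEquiv.contDiff.comp h1

theorem inner_fderiv_gradient_comm {v : (𝔼 n) → ℝ} (hv : ContDiff ℝ 2 v) (x a b : 𝔼 n) :
    ⟪fderiv ℝ (gradient v) x a, b⟫ = ⟪fderiv ℝ (gradient v) x b, a⟫ := by
  have hsymm : IsSymmSndFDerivAt ℝ v x :=
    hv.contDiffAt.isSymmSndFDerivAt (by simp)
  have key : ∀ a b : 𝔼 n, ⟪fderiv ℝ (gradient v) x a, b⟫ = fderiv ℝ (fderiv ℝ v) x a b := by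
    intro a b
    have h1 : DifferentiableAt ℝ (gradient v) x :=
      (contDiff_gradient hv).differentiable one_ne_zero x
    have h2 : DifferentiableAt ℝ (fderiv ℝ v) x :=
      ((hv.fderiv_right (m := 1) (by norm_num)).differentiable one_ne_zero) x
    have e : (fun y => ⟪gradient v y, b⟫) = fun y => fderiv ℝ v y b := by
      ext y; exact inner_gradient_left ..
    have e1 := congrArg (fun F => fderiv ℝ F x a) e
    rw [fderiv_inner_apply ℝ h1 (differentiableAt_const b),
      fderiv_clm_apply h2 (differentiableAt_const b)] at e1
    simpa using e1
  rw [key, key, hsymm.eq]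

theorem hasFDerivAt_sqrt_add_norm_sq {w : (𝔼 n) → 𝔼 n} {x : 𝔼 n} {q : ℝ}
    (hw : DifferentiableAt ℝ w x) (hq : 0 < q + ‖w x‖ ^ 2) :
    HasFDerivAt (fun y => √(q + ‖w y‖ ^ 2))
      ((√(q + ‖w x‖ ^ 2))⁻¹ • (innerSL ℝ (w x)).comp (fderiv ℝ w x)) x := by
  have h1 : HasFDerivAt (fun y => q + ‖w y‖ ^ 2)
      (2 • (innerSL ℝ (w x)).comp (fderiv ℝ w x)) x :=
    (hw.hasFDerivAt.norm_sq).const_add q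
  refine (h1.sqrt hq.ne').congr_fderiv ?_
  ext a
  simp
  field_simp

/-- The divergence of the normalised field `w / √(q + |w|²)`. -/
theorem divg_inv_sqrt_smul {w : (𝔼 n) → 𝔼 n} {x : 𝔼 n} {q : ℝ}
    (hw : DifferentiableAt ℝ w x) (hq : 0 < q + ‖w x‖ ^ 2) :
    divg (fun y => (√(q + ‖w y‖ ^ 2))⁻¹ • w y) x =
      (√(q + ‖w x‖ ^ 2))⁻¹ * divg w x -
        (√(q + ‖w x‖ ^ 2))⁻¹ ^ 3 * ⟪w x, fderiv ℝ w x (w x)⟫ := by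
  have hW := hasFDerivAt_sqrt_add_norm_sq hw hq
  have hpos : 0 < √(q + ‖w x‖ ^ 2) := Real.sqrt_pos.2 hq
  have hinv := (hasDerivAt_inv hpos.ne').comp_hasFDerivAt x hW
  have e := divg_smul hinv.differentiableAt hw
  rw [hinv.fderiv] at e
  refine e.trans ?_
  simp
  field_simp
  ring

theorem divg_variation_field {v : (𝔼 n) → ℝ} (hv : ContDiff ℝ 2 v)
    {g : (𝔼 n) → ℝ} {X : (𝔼 n) → 𝔼 n} {x : 𝔼 n} {q : ℝ} (hq : 0 < q + ‖gradient v x‖ ^ 2)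
    (hg : DifferentiableAt ℝ g x) (hX : DifferentiableAt ℝ X x)
    (hgv : ∃ c : ℝ, fderiv ℝ g x = c • fderiv ℝ v x) :
    divg (fun y => (g y * √(q + ‖gradient v y‖ ^ 2)) • X y -
        (g y * ⟪X y, gradient v y⟫) • ((√(q + ‖gradient v y‖ ^ 2))⁻¹ • gradient v y)) x =
      fderiv ℝ g x (X x) * (√(q + ‖gradient v x‖ ^ 2))⁻¹ * q +
      g x * (√(q + ‖gradient v x‖ ^ 2) * divg X x -
        (√(q + ‖gradient v x‖ ^ 2))⁻¹ * ⟪fderiv ℝ X x (gradient v x), gradient v x⟫ -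
        ⟪X x, gradient v x⟫ *
          divg (fun y => (√(q + ‖gradient v y‖ ^ 2))⁻¹ • gradient v y) x) := by
  have hw : DifferentiableAt ℝ (gradient v) x :=
    (contDiff_gradient hv).differentiable one_ne_zero x
  have hW := hasFDerivAt_sqrt_add_norm_sq hw hq
  have hpos : 0 < √(q + ‖gradient v x‖ ^ 2) := Real.sqrt_pos.2 hq
  have hinv : DifferentiableAt ℝ (fun y => (√(q + ‖gradient v y‖ ^ 2))⁻¹) x :=
    ((hasDerivAt_inv hpos.ne').comp_hasFDerivAt x hW).differentiableAt
  have hgW := hg.hasFDerivAt.fun_mul hW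
  have hXw := hX.hasFDerivAt.inner ℝ hw.hasFDerivAt
  have hgX := hg.hasFDerivAt.fun_mul hXw
  obtain ⟨c, hc⟩ := hgv
  have hB := inner_fderiv_gradient_comm hv x (X x) (gradient v x)
  have hsq : √(q + ‖gradient v x‖ ^ 2) ^ 2 = q + ‖gradient v x‖ ^ 2 := Real.sq_sqrt hq.le
  have hvi : ∀ a, fderiv ℝ v x a = ⟪gradient v x, a⟫ := fun a => (inner_gradient_left ..).symm
  have hqe : q = √(q + ‖gradient v x‖ ^ 2) ^ 2 - ‖gradient v x‖ ^ 2 := by linarith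
  have e1 : divg (fun y => (g y * √(q + ‖gradient v y‖ ^ 2)) • X y) x =
      c * ⟪gradient v x, X x⟫ * √(q + ‖gradient v x‖ ^ 2) +
      g x * (√(q + ‖gradient v x‖ ^ 2))⁻¹ * ⟪gradient v x, fderiv ℝ (gradient v) x (X x)⟫
      + g x * √(q + ‖gradient v x‖ ^ 2) * divg X x := by
    rw [divg_smul hgW.differentiableAt hX, hgW.fderiv, hc]
    simp [hvi, -inner_gradient_left, -mul_eq_mul_left_iff, -mul_eq_mul_right_iff, -inv_eq_zero]
    ring
  have e2 : divg (fun y => (g y * ⟪X y, gradient v y⟫) •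
        ((√(q + ‖gradient v y‖ ^ 2))⁻¹ • gradient v y)) x =
      (√(q + ‖gradient v x‖ ^ 2))⁻¹ * (c * ‖gradient v x‖ ^ 2 * ⟪X x, gradient v x⟫ +
        g x * (⟪fderiv ℝ X x (gradient v x), gradient v x⟫ +
          ⟪X x, fderiv ℝ (gradient v) x (gradient v x)⟫)) +
      g x * ⟪X x, gradient v x⟫ *
        divg (fun y => (√(q + ‖gradient v y‖ ^ 2))⁻¹ • gradient v y) x := by
    rw [divg_smul hgX.differentiableAt (hinv.fun_smul hw), hgX.fderiv, hc]
    simp [hvi, -inner_gradient_left, -mul_eq_mul_left_iff, -mul_eq_mul_right_iff, -inv_eq_zero]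
    ring
  rw [divg_sub (hgW.differentiableAt.fun_smul hX) (hgX.differentiableAt.fun_smul (hinv.fun_smul hw)), e1, e2,
    hc]
  simp only [smul_apply, smul_eq_mul, hvi]
  have hs : ⟪gradient v x, fderiv ℝ (gradient v) x (X x)⟫ =
      ⟪X x, fderiv ℝ (gradient v) x (gradient v x)⟫ := by
    rw [real_inner_comm, hB, real_inner_comm]
  rw [hs, real_inner_comm (X x) (gradient v x)]
  set S := √(q + ‖gradient v x‖ ^ 2)
  set D := divg (fun y => (√(q + ‖gradient v y‖ ^ 2))⁻¹ • gradient v y) x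
  rw [hqe]
  field_simp
  ring

end FirstVariation

section FirstVariation

variable {n : ℕ}

open scoped RealInnerProductSpace

/-- The integrand of the regularised first variation formula for the level sets of `v`. -/
noncomputable def variationIntegrand (v g : (𝔼 n) → ℝ) (X : (𝔼 n) → 𝔼 n) (q : ℝ) (x : 𝔼 n) : ℝ :=
  fderiv ℝ g x (X x) * (√(q + ‖gradient v x‖ ^ 2))⁻¹ * q +
    g x * (√(q + ‖gradient v x‖ ^ 2) * divg X x -
      (√(q + ‖gradient v x‖ ^ 2))⁻¹ * ⟪fderiv ℝ X x (gradient v x), gradient v x⟫ -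
      ⟪X x, gradient v x⟫ *
        ((√(q + ‖gradient v x‖ ^ 2))⁻¹ * divg (gradient v) x -
          (√(q + ‖gradient v x‖ ^ 2))⁻¹ ^ 3 *
            ⟪gradient v x, fderiv ℝ (gradient v) x (gradient v x)⟫))

/-- A continuous majorant of the regularised first variation integrand. -/
noncomputable def variationBound (v g : (𝔼 n) → ℝ) (X : (𝔼 n) → 𝔼 n) (x : 𝔼 n) : ℝ :=
  ‖fderiv ℝ g x‖ * ‖X x‖ + |g x| * ((1 + ‖gradient v x‖) * |divg X x| +
    ‖fderiv ℝ X x‖ * ‖gradient v x‖ +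
    ‖X x‖ * (|divg (gradient v) x| + ‖fderiv ℝ (gradient v) x‖))

theorem integrable_variationBound {v g : (𝔼 n) → ℝ} {X : (𝔼 n) → 𝔼 n} (hv : ContDiff ℝ 2 v)
    (hg : ContDiff ℝ 1 g) (hgc : HasCompactSupport g) (hX : ContDiff ℝ 1 X) :
    Integrable (variationBound v g X) := by
  have hw := contDiff_gradient hv
  have h1 := hg.continuous_fderiv one_ne_zero
  have h2 := hX.continuous_fderiv one_ne_zero
  have h3 := hw.continuous_fderiv one_ne_zero
  have h4 := continuous_divg hX
  have h5 := continuous_divg hw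
  have h6 := hw.continuous
  have h7 := hX.continuous
  have h8 := hg.continuous
  refine Continuous.integrable_of_hasCompactSupport ?_ ?_
  · unfold variationBound; fun_prop
  · refine HasCompactSupport.add (HasCompactSupport.mul_right ?_) (HasCompactSupport.mul_right ?_)
    · exact (hgc.fderiv (𝕜 := ℝ)).norm
    · exact hgc.norm

theorem abs_curvature_term_le {w X : 𝔼 n} {B : (𝔼 n) →L[ℝ] 𝔼 n} {W d : ℝ} (hW : 0 < W)
    (hwW : ‖w‖ ≤ W) :
    |⟪X, w⟫ * (W⁻¹ * d - W⁻¹ ^ 3 * ⟪w, B w⟫)| ≤ ‖X‖ * (|d| + ‖B‖) := by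
  have h1 : |⟪X, w⟫| ≤ ‖X‖ * W :=
    (abs_real_inner_le_norm _ _).trans (by gcongr)
  have h2 : |⟪w, B w⟫| ≤ W ^ 2 * ‖B‖ := by
    calc |⟪w, B w⟫| ≤ ‖w‖ * ‖B w‖ := abs_real_inner_le_norm _ _
      _ ≤ ‖w‖ * (‖B‖ * ‖w‖) := by gcongr; exact B.le_opNorm w
      _ ≤ W * (‖B‖ * W) := by gcongr
      _ = _ := by ring
  rw [abs_mul]
  calc |⟪X, w⟫| * |W⁻¹ * d - W⁻¹ ^ 3 * ⟪w, B w⟫|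
      ≤ (‖X‖ * W) * (W⁻¹ * |d| + W⁻¹ ^ 3 * (W ^ 2 * ‖B‖)) := by
        gcongr
        refine (abs_sub _ _).trans ?_
        rw [abs_mul, abs_mul, abs_of_pos (inv_pos.2 hW), abs_of_pos (pow_pos (inv_pos.2 hW) 3)]
        gcongr
    _ = _ := by field_simp

theorem abs_variationIntegrand_le {v g : (𝔼 n) → ℝ} {X : (𝔼 n) → 𝔼 n} {q : ℝ} (hq : 0 < q)
    (hq1 : q ≤ 1) (x : 𝔼 n) : |variationIntegrand v g X q x| ≤ variationBound v g X x := by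
  unfold variationIntegrand variationBound
  set w := gradient v x
  set W := √(q + ‖w‖ ^ 2) with hWdef
  have hW : 0 < W := Real.sqrt_pos.2 (by positivity)
  have hwW : ‖w‖ ≤ W := Real.le_sqrt_of_sq_le (by linarith)
  have hW1 : W ≤ 1 + ‖w‖ := by
    refine Real.sqrt_le_iff.2 ⟨by positivity, ?_⟩
    nlinarith [norm_nonneg w]
  have hqW : q ≤ W := Real.le_sqrt_of_sq_le (by nlinarith [sq_nonneg ‖w‖])
  have hc := abs_curvature_term_le (X := X x) (B := fderiv ℝ (gradient v) x)
    (d := divg (gradient v) x) hW hwW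
  have hA : |fderiv ℝ g x (X x) * W⁻¹ * q| ≤ ‖fderiv ℝ g x‖ * ‖X x‖ := by
    rw [mul_assoc, abs_mul]
    have : |W⁻¹ * q| ≤ 1 := by
      rw [abs_of_pos (by positivity), inv_mul_le_one₀ hW]; exact hqW
    calc _ ≤ (‖fderiv ℝ g x‖ * ‖X x‖) * 1 := by
          gcongr; exact (fderiv ℝ g x).le_opNorm _
      _ = _ := mul_one _
  have hB : |W⁻¹ * ⟪fderiv ℝ X x w, w⟫| ≤ ‖fderiv ℝ X x‖ * ‖w‖ := by
    rw [abs_mul, abs_of_pos (inv_pos.2 hW), inv_mul_le_iff₀ hW]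
    calc _ ≤ ‖fderiv ℝ X x w‖ * ‖w‖ := abs_real_inner_le_norm _ _
      _ ≤ ‖fderiv ℝ X x‖ * ‖w‖ * ‖w‖ := by gcongr; exact (fderiv ℝ X x).le_opNorm _
      _ ≤ W * (‖fderiv ℝ X x‖ * ‖w‖) := by rw [mul_comm]; gcongr
  have hD : |W * divg X x| ≤ (1 + ‖w‖) * |divg X x| := by
    rw [abs_mul, abs_of_pos hW]; gcongr
  refine (abs_add_le _ _).trans (add_le_add hA ?_)
  rw [abs_mul]
  gcongr
  refine (abs_sub _ _).trans (add_le_add ((abs_sub _ _).trans (add_le_add hD hB)) hc)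

theorem integral_variationIntegrand {v g : (𝔼 n) → ℝ} {X : (𝔼 n) → 𝔼 n} (hv : ContDiff ℝ 2 v)
    (hg : ContDiff ℝ 1 g) (hgc : HasCompactSupport g) (hX : ContDiff ℝ 1 X)
    (hgv : ∀ x, ∃ c : ℝ, fderiv ℝ g x = c • fderiv ℝ v x) {q : ℝ} (hq : 0 < q) :
    ∫ x, variationIntegrand v g X q x = 0 := by
  have hw := contDiff_gradient hv
  have hpos : ∀ x, 0 < q + ‖gradient v x‖ ^ 2 := fun x => by positivity
  have hWc : ContDiff ℝ 1 fun y => √(q + ‖gradient v y‖ ^ 2) :=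
    (contDiff_const.add (hw.norm_sq ℝ)).sqrt fun x => (hpos x).ne'
  have hWi : ContDiff ℝ 1 fun y => (√(q + ‖gradient v y‖ ^ 2))⁻¹ :=
    hWc.inv fun x => (Real.sqrt_pos.2 (hpos x)).ne'
  have hY := integral_divg_eq_zero (V := fun y => (g y * √(q + ‖gradient v y‖ ^ 2)) • X y -
      (g y * ⟪X y, gradient v y⟫) • ((√(q + ‖gradient v y‖ ^ 2))⁻¹ • gradient v y))
    (((hg.mul hWc).smul hX).sub ((hg.mul (hX.inner ℝ hw)).smul (hWi.smul hw)))
    (hgc.mul_right.smul_right.sub hgc.mul_right.smul_right)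
  rw [← hY]
  refine integral_congr_ae (Eventually.of_forall fun x => ?_)
  rw [divg_variation_field hv (hpos x) (hg.differentiable one_ne_zero x)
    (hX.differentiable one_ne_zero x) (hgv x),
    divg_inv_sqrt_smul (hw.differentiable one_ne_zero x) (hpos x)]
  rfl

theorem divg_inv_norm_smul {v : (𝔼 n) → ℝ} (hv : ContDiff ℝ 2 v) {x : 𝔼 n}
    (hx : gradient v x ≠ 0) :
    divg (fun y => ‖gradient v y‖⁻¹ • gradient v y) x =
      ‖gradient v x‖⁻¹ * divg (gradient v) x -
        ‖gradient v x‖⁻¹ ^ 3 * ⟪gradient v x, fderiv ℝ (gradient v) x (gradient v x)⟫ := by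
  have h := divg_inv_sqrt_smul (q := 0) ((contDiff_gradient hv).differentiable one_ne_zero x)
    (by have := norm_pos_iff.2 hx; positivity)
  simpa using h

theorem tendsto_variationIntegrand {v g : (𝔼 n) → ℝ} {X : (𝔼 n) → 𝔼 n} (hv : ContDiff ℝ 2 v)
    (x : 𝔼 n) (hgv : ∃ c : ℝ, fderiv ℝ g x = c • fderiv ℝ v x) :
    Tendsto (fun q => variationIntegrand v g X q x) (𝓝 0)
      (𝓝 (g x * (‖gradient v x‖ * divg X x -
        ‖gradient v x‖⁻¹ * ⟪fderiv ℝ X x (gradient v x), gradient v x⟫ -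
        ⟪X x, gradient v x⟫ * divg (fun y => ‖gradient v y‖⁻¹ • gradient v y) x))) := by
  by_cases hx : gradient v x = 0
  · obtain ⟨c, hc⟩ := hgv
    have hv0 : fderiv ℝ v x = 0 := by
      rw [← toDual_gradient, hx, map_zero]
    have : ContinuousAt (fun q => variationIntegrand v g X q x) 0 := by
      unfold variationIntegrand
      simp only [hx, hc, hv0]
      simp only [inner_zero_right, map_zero, norm_zero]
      simp only [smul_zero, zero_apply, zero_mul, mul_zero]
      fun_prop
    convert this.tendsto using 2
    simp [variationIntegrand, hx]
  · have hne : √(0 + ‖gradient v x‖ ^ 2) ≠ 0 := by simpa using hx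
    have : ContinuousAt (fun q => variationIntegrand v g X q x) 0 := by
      unfold variationIntegrand
      fun_prop (disch := exact hne)
    convert this.tendsto using 2
    simp [variationIntegrand, divg_inv_norm_smul hv hx, -inner_gradient_left,
      -inner_gradient_right]

theorem measurable_divg (V : (𝔼 n) → 𝔼 n) : Measurable (divg V) := by
  unfold divg
  refine Finset.measurable_sum _ fun i _ => ?_
  exact (EuclideanSpace.proj i : (𝔼 n) →L[ℝ] ℝ).continuous.measurable.comp
    (measurable_fderiv_apply_const ℝ V _)

/-- First variation inequality for the level sets of `v`. -/
theorem lintegral_le_of_tangential_divergence {v g : (𝔼 n) → ℝ} {X : (𝔼 n) → 𝔼 n} {T : (𝔼 n) → ℝ}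
    (hv : ContDiff ℝ 2 v) (hg : ContDiff ℝ 1 g) (hgc : HasCompactSupport g) (hg0 : ∀ x, 0 ≤ g x)
    (hX : ContDiff ℝ 1 X) (hgv : ∀ x, ∃ c : ℝ, fderiv ℝ g x = c • fderiv ℝ v x)
    (hT0 : ∀ x, 0 ≤ T x)
    (hT : ∀ x, T x * ‖gradient v x‖ ≤ ‖gradient v x‖ * divg X x -
        ‖gradient v x‖⁻¹ * ⟪fderiv ℝ X x (gradient v x), gradient v x⟫) :
    ∫⁻ x, ENNReal.ofReal (g x * (T x * ‖gradient v x‖)) ≤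
      ∫⁻ x, ENNReal.ofReal (g x * (‖X x‖ * ‖gradient v x‖ *
        |divg (fun y => ‖gradient v y‖⁻¹ • gradient v y) x|)) := by
  have hw := contDiff_gradient hv
  set F : (𝔼 n) → ℝ := fun x => g x * (‖gradient v x‖ * divg X x -
        ‖gradient v x‖⁻¹ * ⟪fderiv ℝ X x (gradient v x), gradient v x⟫ -
        ⟪X x, gradient v x⟫ * divg (fun y => ‖gradient v y‖⁻¹ • gradient v y) x) with hF
  set b : (𝔼 n) → ℝ := fun x => g x * (‖X x‖ * ‖gradient v x‖ *
        |divg (fun y => ‖gradient v y‖⁻¹ • gradient v y) x|) with hb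
  set u : ℕ → ℝ := fun m => 1 / ((m : ℝ) + 1)
  have hu : Tendsto u atTop (𝓝 0) := tendsto_one_div_add_atTop_nhds_zero_nat
  have hu0 : ∀ m, 0 < u m := fun m => by positivity
  have hu1 : ∀ m, u m ≤ 1 := fun m => by
    rw [div_le_one (by positivity)]; linarith [(Nat.cast_nonneg m : (0 : ℝ) ≤ m)]
  have hlim : ∀ x, Tendsto (fun m => variationIntegrand v g X (u m) x) atTop (𝓝 (F x)) :=
    fun x => (tendsto_variationIntegrand hv x (hgv x)).comp hu
  have hbd := integrable_variationBound hv hg hgc hX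
  have hmeas : ∀ m, AEStronglyMeasurable (variationIntegrand v g X (u m)) volume := by
    intro m
    have h1 := hg.continuous_fderiv one_ne_zero
    have h2 := hX.continuous_fderiv one_ne_zero
    have h3 := hw.continuous_fderiv one_ne_zero
    have h4 := continuous_divg hX
    have h5 := continuous_divg hw
    have h6 := hw.continuous
    have h7 := hX.continuous
    have h8 := hg.continuous
    have h9 : ∀ x, √(u m + ‖gradient v x‖ ^ 2) ≠ 0 := fun x =>
      (Real.sqrt_pos.2 (by have := hu0 m; positivity)).ne'
    refine Continuous.aestronglyMeasurable ?_
    unfold variationIntegrand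
    fun_prop (disch := exact h9)
  have hFint : Integrable F := by
    refine hbd.mono' (aestronglyMeasurable_of_tendsto_ae atTop hmeas (.of_forall hlim))
      (.of_forall fun x => ?_)
    exact le_of_tendsto (hlim x).norm
      (.of_forall fun m => abs_variationIntegrand_le (hu0 m) (hu1 m) x)
  have hF0 : ∫ x, F x = 0 := by
    have := tendsto_integral_of_dominated_convergence _ hmeas hbd
      (fun m => .of_forall fun x => abs_variationIntegrand_le (hu0 m) (hu1 m) x)
      (.of_forall hlim)
    simp_rw [integral_variationIntegrand hv hg hgc hX hgv (hu0 _)] at this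
    exact tendsto_nhds_unique this tendsto_const_nhds
  have hb0 : ∀ x, 0 ≤ b x := fun x => by have := hg0 x; positivity
  have hbint : Integrable b := by
    refine hbd.mono' ?_ (.of_forall fun x => ?_)
    · have h1 : Measurable g := hg.continuous.measurable
      have h2 : Measurable X := hX.continuous.measurable
      have h3 : Measurable (gradient v) := hw.continuous.measurable
      have h4 := measurable_divg (fun y => ‖gradient v y‖⁻¹ • gradient v y)
      exact (h1.mul ((h2.norm.mul h3.norm).mul h4.abs)).aestronglyMeasurable
    · rw [Real.norm_of_nonneg (hb0 x)]
      unfold variationBound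
      have hcurv : ‖gradient v x‖ * |divg (fun y => ‖gradient v y‖⁻¹ • gradient v y) x| ≤
          |divg (gradient v) x| + ‖fderiv ℝ (gradient v) x‖ := by
        by_cases hx : gradient v x = 0
        · rw [hx]; simp; positivity
        · have hp := norm_pos_iff.2 hx
          have := abs_curvature_term_le (X := ‖gradient v x‖⁻¹ • gradient v x)
            (B := fderiv ℝ (gradient v) x) (d := divg (gradient v) x) hp le_rfl
          rw [← divg_inv_norm_smul hv hx, abs_mul, real_inner_smul_left, real_inner_self_eq_norm_sq,
            norm_smul, norm_inv, norm_norm, inv_mul_cancel₀ hp.ne', one_mul, sq,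
            inv_mul_cancel_left₀ hp.ne', abs_norm] at this
          exact this
      have : b x ≤ |g x| * (‖X x‖ * (|divg (gradient v) x| + ‖fderiv ℝ (gradient v) x‖)) := by
        simp only [hb, mul_assoc]
        rw [abs_of_nonneg (hg0 x)]
        have := hg0 x
        gcongr
      refine this.trans ?_
      rw [mul_add |g x| (_ + _)]
      have : 0 ≤ ‖fderiv ℝ g x‖ * ‖X x‖ := by positivity
      have : 0 ≤ |g x| * ((1 + ‖gradient v x‖) * |divg X x| +
        ‖fderiv ℝ X x‖ * ‖gradient v x‖) := by positivity
      linarith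
  have hle : ∀ x, g x * (T x * ‖gradient v x‖) ≤ F x + b x := by
    intro x
    have h1 : ⟪X x, gradient v x⟫ * divg (fun y => ‖gradient v y‖⁻¹ • gradient v y) x ≤
        ‖X x‖ * ‖gradient v x‖ * |divg (fun y => ‖gradient v y‖⁻¹ • gradient v y) x| := by
      refine (le_abs_self _).trans ?_
      rw [abs_mul]
      gcongr
      exact abs_real_inner_le_norm _ _
    simp only [hF, hb]
    rw [← mul_add]
    exact mul_le_mul_of_nonneg_left (by linarith [hT x]) (hg0 x)
  calc _ ≤ ∫⁻ x, ENNReal.ofReal (F x + b x) :=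
        lintegral_mono fun x => ENNReal.ofReal_le_ofReal (hle x)
    _ = ENNReal.ofReal (∫ x, (F x + b x)) := by
        refine (ofReal_integral_eq_lintegral_ofReal (f := fun x => F x + b x)
          (hFint.add hbint) ?_).symm
        exact .of_forall fun x => le_trans (by have := hg0 x; have := hT0 x; positivity) (hle x)
    _ = ENNReal.ofReal (∫ x, b x) := by rw [integral_add hFint hbint, hF0, zero_add]
    _ = _ := ofReal_integral_eq_lintegral_ofReal hbint (.of_forall hb0)

end FirstVariation

section Cutoff

variable {n : ℕ}

theorem isCompact_closure_inter_le_abs {Ω : Set (𝔼 n)} (hb : IsBounded Ω) {v : (𝔼 n) → ℝ}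
    (hv : Continuous v) (τ : ℝ) : IsCompact (closure Ω ∩ {x | τ ≤ |v x|}) :=
  hb.isCompact_closure.inter_right (isClosed_le continuous_const hv.abs)

theorem closure_inter_le_abs_subset {Ω : Set (𝔼 n)} (hΩ : IsOpen Ω) {v : (𝔼 n) → ℝ}
    (hv0 : ∀ x ∈ frontier Ω, v x = 0) {τ : ℝ} (hτ : 0 < τ) :
    closure Ω ∩ {x | τ ≤ |v x|} ⊆ Ω := by
  rintro x ⟨hx, hx'⟩
  by_contra hxΩ
  have := hv0 x (by rw [frontier, hΩ.interior_eq]; exact ⟨hx, hxΩ⟩)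
  simp only [Set.mem_ofPred_eq, this, abs_zero] at hx'
  linarith

theorem cutoff_eventually_eq {Ω : Set (𝔼 n)} (hΩ : IsOpen Ω) (hb : IsBounded Ω)
    {v : (𝔼 n) → ℝ} (hv : Continuous v) (hv0 : ∀ x ∈ frontier Ω, v x = 0) {P : ℝ → ℝ} {τ : ℝ}
    (hτ : 0 < τ) (hPτ : ∀ s, |s| < τ → P s = 0) (x : 𝔼 n) :
    (x ∈ Ω ∧ Ω.indicator (fun y => P (v y)) =ᶠ[𝓝 x] fun y => P (v y)) ∨
      (Ω.indicator (fun y => deriv P (v y) • fderiv ℝ v y) x = 0 ∧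
        Ω.indicator (fun y => P (v y)) =ᶠ[𝓝 x] fun _ => 0) := by
  by_cases hx : x ∈ Ω
  · exact .inl ⟨hx, (hΩ.eventually_mem hx).mono fun y hy => Set.indicator_of_mem hy _⟩
  · refine .inr ⟨Set.indicator_of_notMem hx _, ?_⟩
    have hK : IsClosed (closure Ω ∩ {x | τ ≤ |v x|}) :=
      (isCompact_closure_inter_le_abs hb hv τ).isClosed
    have hxK : x ∈ (closure Ω ∩ {x | τ ≤ |v x|})ᶜ :=
      fun h => hx (closure_inter_le_abs_subset hΩ hv0 hτ h)
    refine (hK.isOpen_compl.eventually_mem hxK).mono fun y hy => ?_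
    by_cases hyΩ : y ∈ Ω
    · rw [Set.indicator_of_mem hyΩ]
      exact hPτ _ (not_le.1 fun h => hy ⟨subset_closure hyΩ, h⟩)
    · exact Set.indicator_of_notMem hyΩ _

theorem contDiff_cutoff {Ω : Set (𝔼 n)} (hΩ : IsOpen Ω) (hb : IsBounded Ω)
    {v : (𝔼 n) → ℝ} (hv : ContDiff ℝ 1 v) (hv0 : ∀ x ∈ frontier Ω, v x = 0) {P : ℝ → ℝ}
    (hP : ContDiff ℝ 1 P) {τ : ℝ} (hτ : 0 < τ) (hPτ : ∀ s, |s| < τ → P s = 0) :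
    ContDiff ℝ 1 (Ω.indicator fun y => P (v y)) := by
  refine contDiff_iff_contDiffAt.2 fun x => ?_
  rcases cutoff_eventually_eq hΩ hb hv.continuous hv0 hτ hPτ x with ⟨-, h⟩ | ⟨-, h⟩
  · exact (hP.comp hv).contDiffAt.congr_of_eventuallyEq h
  · exact contDiffAt_const.congr_of_eventuallyEq h

theorem hasFDerivAt_cutoff {Ω : Set (𝔼 n)} (hΩ : IsOpen Ω) (hb : IsBounded Ω)
    {v : (𝔼 n) → ℝ} (hv : ContDiff ℝ 1 v) (hv0 : ∀ x ∈ frontier Ω, v x = 0) {P : ℝ → ℝ}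
    (hP : ContDiff ℝ 1 P) {τ : ℝ} (hτ : 0 < τ) (hPτ : ∀ s, |s| < τ → P s = 0) (x : 𝔼 n) :
    HasFDerivAt (Ω.indicator fun y => P (v y))
      (Ω.indicator (fun y => deriv P (v y) • fderiv ℝ v y) x) x := by
  rcases cutoff_eventually_eq hΩ hb hv.continuous hv0 hτ hPτ x with ⟨hx, h⟩ | ⟨hx, h⟩
  · rw [Set.indicator_of_mem hx]
    exact HasFDerivAt.congr_of_eventuallyEq
      ((hP.differentiable one_ne_zero (v x)).hasDerivAt.comp_hasFDerivAt x
        (hv.differentiable one_ne_zero x).hasFDerivAt) h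
  · rw [hx]
    exact (hasFDerivAt_const (0 : ℝ) x).congr_of_eventuallyEq h

theorem hasCompactSupport_cutoff {Ω : Set (𝔼 n)} (hb : IsBounded Ω)
    {v : (𝔼 n) → ℝ} (P : ℝ → ℝ) : HasCompactSupport (Ω.indicator fun y => P (v y)) :=
  HasCompactSupport.of_support_subset_isCompact hb.isCompact_closure
    ((Set.support_indicator_subset).trans subset_closure)

theorem contDiff_comp_abs {ψ : ℝ → ℝ} (hψ : ContDiff ℝ 1 ψ) {τ : ℝ} (hτ : 0 < τ)
    (hψτ : ∀ s < τ, ψ s = 0) : ContDiff ℝ 1 fun s => ψ |s| := by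
  refine contDiff_iff_contDiffAt.2 fun s => ?_
  by_cases hs : s = 0
  · refine (contDiffAt_const (c := (0 : ℝ))).congr_of_eventuallyEq ?_
    have : ∀ᶠ y in 𝓝 s, |y| < τ :=
      continuous_abs.continuousAt.eventually (gt_mem_nhds (by simpa [hs] using hτ))
    exact this.mono fun y hy => hψτ _ hy
  · exact hψ.contDiffAt.comp s (contDiffAt_abs hs)

end Cutoff

section Monotonicity

variable {n : ℕ}

open scoped RealInnerProductSpace

theorem divg_sub_const (x y : 𝔼 n) : divg (fun z => z - x) y = n := by
  have : fderiv ℝ (fun z : 𝔼 n => z - x) y = ContinuousLinearMap.id ℝ _ := by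
    rw [fderiv_sub_const, fderiv_fun_id]
  simp [divg, this]

/-- The regularised radial field used to test the first variation inequality. -/
noncomputable def radialField (x : 𝔼 n) (k ρ : ℝ) (y : 𝔼 n) : 𝔼 n :=
  (‖y - x‖ ^ 2 + ρ ^ 2) ^ (-k / 2) • (y - x)

theorem hasFDerivAt_radialWeight (x y : 𝔼 n) (k : ℝ) {ρ : ℝ} (hρ : 0 < ρ) :
    HasFDerivAt (fun y => (‖y - x‖ ^ 2 + ρ ^ 2) ^ (-k / 2))
      ((-k * (‖y - x‖ ^ 2 + ρ ^ 2) ^ (-k / 2 - 1)) • innerSL ℝ (y - x)) y := by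
  have h1 : HasFDerivAt (fun y : 𝔼 n => ‖y - x‖ ^ 2 + ρ ^ 2) (2 • innerSL ℝ (y - x)) y := by
    have := (((hasFDerivAt_id y).sub_const x).norm_sq).add_const (ρ ^ 2)
    refine this.congr_fderiv ?_
    ext w; simp
  refine (h1.rpow_const (p := -k / 2) (.inl (by positivity))).congr_fderiv ?_
  ext w
  simp
  ring

theorem contDiff_radialField (x : 𝔼 n) (k : ℝ) {ρ : ℝ} (hρ : 0 < ρ) :
    ContDiff ℝ 1 (radialField x k ρ) := by
  have h1 : ContDiff ℝ 1 fun y : 𝔼 n => y - x := contDiff_id.sub contDiff_const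
  exact (((h1.norm_sq ℝ).add contDiff_const).rpow_const_of_ne
    fun y => by positivity).smul h1

theorem norm_radialField_le (x y : 𝔼 n) {k ρ : ℝ} (hk : 0 ≤ k) :
    ‖radialField x k ρ y‖ ≤ ‖y - x‖ ^ (1 - k) := by
  rcases (norm_nonneg (y - x)).eq_or_lt with h | h
  · have : y - x = 0 := norm_eq_zero.1 h.symm
    simp only [radialField, this, smul_zero, norm_zero]
    exact Real.rpow_nonneg le_rfl _
  · rw [radialField, norm_smul, Real.norm_of_nonneg (by positivity)]
    calc _ ≤ (‖y - x‖ ^ 2) ^ (-k / 2) * ‖y - x‖ := by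
          refine mul_le_mul_of_nonneg_right ?_ h.le
          exact Real.rpow_le_rpow_of_nonpos (by positivity) (by nlinarith [sq_nonneg ρ])
            (by linarith)
      _ = ‖y - x‖ ^ (1 - k) := by
          rw [← Real.rpow_natCast, ← Real.rpow_mul h.le, ← Real.rpow_add_one h.ne']
          congr 1; push_cast; ring

theorem radialField_divergence_le {k : ℝ} (hk : k = n - 1) (hk0 : 0 ≤ k) (x y w : 𝔼 n) {ρ : ℝ}
    (hρ : 0 < ρ) :
    k * ρ ^ 2 * (‖y - x‖ ^ 2 + ρ ^ 2) ^ (-k / 2 - 1) * ‖w‖ ≤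
      ‖w‖ * divg (radialField x k ρ) y -
        ‖w‖⁻¹ * ⟪fderiv ℝ (radialField x k ρ) y w, w⟫ := by
  rcases (norm_nonneg w).eq_or_lt with hw | hw
  · simp [← hw]
  set q := ‖y - x‖ ^ 2 + ρ ^ 2 with hq
  have hq0 : 0 < q := by positivity
  set G := q ^ (-k / 2 - 1) with hG
  have hGF : q ^ (-k / 2) = G * q := by
    rw [hG, ← Real.rpow_add_one hq0.ne']; congr 1; ring
  have hF := hasFDerivAt_radialWeight x y k hρ
  have hz : HasFDerivAt (fun z : 𝔼 n => z - x) (ContinuousLinearMap.id ℝ (𝔼 n)) y :=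
    (hasFDerivAt_id y).sub_const x
  have hdiv : divg (radialField x k ρ) y = n * (G * q) - k * G * ‖y - x‖ ^ 2 := by
    unfold radialField
    rw [divg_smul hF.differentiableAt hz.differentiableAt, hF.fderiv, divg_sub_const, ← hq, hGF]
    rw [← hG, smul_apply, innerSL_apply_apply, real_inner_self_eq_norm_sq, smul_eq_mul]
    ring
  have hD : ⟪fderiv ℝ (radialField x k ρ) y w, w⟫ =
      G * q * ‖w‖ ^ 2 - k * G * ⟪y - x, w⟫ ^ 2 := by
    have : fderiv ℝ (radialField x k ρ) y = _ := (hF.smul hz).fderiv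
    rw [this, ← hq, hGF, ← hG]
    simp only [add_apply, smul_apply,
      ContinuousLinearMap.smulRight_apply, ContinuousLinearMap.id_apply, innerSL_apply_apply,
      inner_add_left, real_inner_smul_left, real_inner_self_eq_norm_sq, smul_eq_mul]
    ring
  have hG0 : 0 ≤ G := by positivity
  have h1 : ‖w‖⁻¹ * (G * q * ‖w‖ ^ 2 - k * G * ⟪y - x, w⟫ ^ 2) ≤ ‖w‖ * (G * q) := by
    have : ‖w‖⁻¹ * (G * q * ‖w‖ ^ 2 - k * G * ⟪y - x, w⟫ ^ 2) =
        ‖w‖ * (G * q) - ‖w‖⁻¹ * (k * G * ⟪y - x, w⟫ ^ 2) := by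
      field_simp
    rw [this]
    have : 0 ≤ ‖w‖⁻¹ * (k * G * ⟪y - x, w⟫ ^ 2) := by positivity
    linarith
  rw [hdiv, hD]
  refine le_trans (le_of_eq ?_) (sub_le_sub_left h1 _)
  rw [show (n : ℝ) = k + 1 by rw [hk]; ring, hq]
  ring

theorem abs_divg_eq_meanCurv {v : (𝔼 n) → ℝ} (hn : 2 ≤ n) (x : 𝔼 n) :
    |divg (fun y => ‖gradient v y‖⁻¹ • gradient v y) x| = ((n : ℝ) - 1) * |meanCurv v x| := by
  have : (0 : ℝ) < (n : ℝ) - 1 := by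
    have : (2 : ℝ) ≤ n := by exact_mod_cast hn
    linarith
  rw [meanCurv, abs_mul, abs_neg, abs_of_pos (by positivity : 0 < 1 / ((n : ℝ) - 1))]
  field_simp

theorem measurable_meanCurv (v : (𝔼 n) → ℝ) : Measurable (meanCurv v) :=
  (measurable_divg _).const_mul _

/-- Weighted monotonicity inequality for the level sets of `v`. -/
theorem withDensity_ball_le (hn : 2 ≤ n) {v g : (𝔼 n) → ℝ} (hv : ContDiff ℝ 2 v)
    (hg : ContDiff ℝ 1 g) (hgc : HasCompactSupport g) (hg0 : ∀ x, 0 ≤ g x)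
    (hgv : ∀ x, ∃ c : ℝ, fderiv ℝ g x = c • fderiv ℝ v x) (x : 𝔼 n) {ρ : ℝ} (hρ : 0 < ρ) :
    (volume.withDensity fun y => ENNReal.ofReal (g y * ‖gradient v y‖)) (Metric.ball x ρ) ≤
      ENNReal.ofReal (2 ^ (((n : ℝ) - 1) / 2 + 1)) * ENNReal.ofReal ρ ^ ((n : ℝ) - 1) *
        ∫⁻ y, ENNReal.ofReal (‖y - x‖ ^ (1 - ((n : ℝ) - 1))) * ENNReal.ofReal |meanCurv v y|
          ∂(volume.withDensity fun y => ENNReal.ofReal (g y * ‖gradient v y‖)) := by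
  set k : ℝ := (n : ℝ) - 1 with hk
  have hk0 : 0 < k := by
    have : (2 : ℝ) ≤ n := by exact_mod_cast hn
    linarith
  have hgm : Measurable g := hg.continuous.measurable
  have hwm : Measurable (gradient v) := (contDiff_gradient hv).continuous.measurable
  have hmm : Measurable fun y => ENNReal.ofReal (g y * ‖gradient v y‖) :=
    (hgm.mul hwm.norm).ennreal_ofReal
  have main := lintegral_le_of_tangential_divergence hv hg hgc hg0
    (contDiff_radialField x k hρ) hgv
    (T := fun y => k * ρ ^ 2 * (‖y - x‖ ^ 2 + ρ ^ 2) ^ (-k / 2 - 1))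
    (fun y => by positivity) (fun y => radialField_divergence_le hk hk0.le x y _ hρ)
  set D : ℝ := 2 ^ (k / 2 + 1) * ρ ^ k with hD
  have hD0 : 0 < D := by positivity
  have hlow : ∀ y ∈ Metric.ball x ρ, k ≤
      D * (k * ρ ^ 2 * (‖y - x‖ ^ 2 + ρ ^ 2) ^ (-k / 2 - 1)) := by
    intro y hy
    rw [Metric.mem_ball, dist_eq_norm] at hy
    have h1 : (2 * ρ ^ 2) ^ (-k / 2 - 1) ≤ (‖y - x‖ ^ 2 + ρ ^ 2) ^ (-k / 2 - 1) := by
      refine Real.rpow_le_rpow_of_nonpos (by positivity) ?_ (by linarith)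
      nlinarith [norm_nonneg (y - x)]
    have h2 : D * (ρ ^ 2 * (2 * ρ ^ 2) ^ (-k / 2 - 1)) = 1 := by
      rw [hD, Real.mul_rpow (by norm_num) (by positivity), ← Real.rpow_natCast ρ 2,
        ← Real.rpow_mul hρ.le]
      calc _ = (2 ^ (k / 2 + 1) * (2 : ℝ) ^ (-k / 2 - 1)) *
            (ρ ^ k * ρ ^ ((2 : ℕ) : ℝ) * ρ ^ (((2 : ℕ) : ℝ) * (-k / 2 - 1))) := by ring
        _ = 1 := by
          rw [← Real.rpow_add (by norm_num), ← Real.rpow_add hρ, ← Real.rpow_add hρ]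
          rw [show k / 2 + 1 + (-k / 2 - 1) = 0 by ring,
            show k + ((2 : ℕ) : ℝ) + ((2 : ℕ) : ℝ) * (-k / 2 - 1) = 0 by push_cast; ring]
          simp
    calc k = k * (D * (ρ ^ 2 * (2 * ρ ^ 2) ^ (-k / 2 - 1))) := by rw [h2, mul_one]
      _ ≤ k * (D * (ρ ^ 2 * (‖y - x‖ ^ 2 + ρ ^ 2) ^ (-k / 2 - 1))) := by gcongr
      _ = _ := by ring
  have hkey : ENNReal.ofReal k * (volume.withDensity fun y => ENNReal.ofReal (g y * ‖gradient v y‖))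
      (Metric.ball x ρ) ≤ ENNReal.ofReal k * (ENNReal.ofReal D *
        ∫⁻ y, ENNReal.ofReal (‖y - x‖ ^ (1 - k)) * ENNReal.ofReal |meanCurv v y|
          ∂(volume.withDensity fun y => ENNReal.ofReal (g y * ‖gradient v y‖))) := by
    have hHm := measurable_meanCurv v
    rw [withDensity_apply _ measurableSet_ball, lintegral_withDensity_eq_lintegral_mul _ hmm
      (by fun_prop), ← lintegral_const_mul _ hmm]
    calc _ ≤ ∫⁻ y in Metric.ball x ρ, ENNReal.ofReal D * ENNReal.ofReal
            (g y * ((k * ρ ^ 2 * (‖y - x‖ ^ 2 + ρ ^ 2) ^ (-k / 2 - 1)) * ‖gradient v y‖)) := by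
          refine setLIntegral_mono' measurableSet_ball fun y hy => ?_
          rw [← ENNReal.ofReal_mul hk0.le, ← ENNReal.ofReal_mul hD0.le]
          refine ENNReal.ofReal_le_ofReal ?_
          have := mul_le_mul_of_nonneg_right (hlow y hy)
            (mul_nonneg (hg0 y) (norm_nonneg (gradient v y)))
          linarith
      _ ≤ ENNReal.ofReal D * ∫⁻ y, ENNReal.ofReal
            (g y * ((k * ρ ^ 2 * (‖y - x‖ ^ 2 + ρ ^ 2) ^ (-k / 2 - 1)) * ‖gradient v y‖)) := by
          rw [← lintegral_const_mul' _ _ ENNReal.ofReal_ne_top]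
          exact setLIntegral_le_lintegral _ _
      _ ≤ ENNReal.ofReal D * _ := mul_le_mul_right main _
      _ ≤ ENNReal.ofReal D * ∫⁻ y, ENNReal.ofReal k * (ENNReal.ofReal (g y * ‖gradient v y‖) *
            (ENNReal.ofReal (‖y - x‖ ^ (1 - k)) * ENNReal.ofReal |meanCurv v y|)) := by
          refine mul_le_mul_right (lintegral_mono fun y => ?_) _
          have := hg0 y
          rw [← ENNReal.ofReal_mul (by positivity), ← ENNReal.ofReal_mul (by positivity),
            ← ENNReal.ofReal_mul hk0.le]
          refine ENNReal.ofReal_le_ofReal ?_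
          rw [abs_divg_eq_meanCurv hn]
          calc _ ≤ g y * (‖y - x‖ ^ (1 - k) * ‖gradient v y‖ * (k * |meanCurv v y|)) := by
                have := norm_radialField_le x y (ρ := ρ) hk0.le
                gcongr
            _ = _ := by ring
      _ = _ := by
          rw [lintegral_const_mul' _ _ ENNReal.ofReal_ne_top]
          simp only [Pi.mul_apply]
          ring
  have := (ENNReal.mul_le_mul_iff_right (by simpa using hk0) ENNReal.ofReal_ne_top).1 hkey
  rwa [hD, ENNReal.ofReal_mul (by positivity), ← ENNReal.ofReal_rpow_of_pos hρ] at this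

end Monotonicity

section MichaelSimon

variable {n : ℕ}

theorem lowerSemicontinuous_measure_ball (μ : Measure (𝔼 n)) (ρ : ℝ) :
    LowerSemicontinuous fun x => μ (Metric.ball x ρ) := by
  intro x a ha
  have hU : Metric.ball x ρ = ⋃ m : ℕ, Metric.ball x (ρ - 1 / ((m : ℝ) + 1)) := by
    ext y
    simp only [Set.mem_iUnion, Metric.mem_ball]
    constructor
    · intro h
      obtain ⟨m, hm⟩ := exists_nat_one_div_lt (sub_pos.2 h)
      exact ⟨m, by linarith⟩
    · rintro ⟨m, hm⟩
      have : (0 : ℝ) < 1 / ((m : ℝ) + 1) := by positivity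
      linarith
  have hmono : Monotone fun m : ℕ => Metric.ball x (ρ - 1 / ((m : ℝ) + 1)) := by
    intro i j hij
    refine Metric.ball_subset_ball ?_
    have := one_div_le_one_div_of_le (by positivity) (show (i : ℝ) + 1 ≤ j + 1 by
      have : (i : ℝ) ≤ j := by exact_mod_cast hij
      linarith)
    linarith
  have ht := tendsto_measure_iUnion_atTop (μ := μ) hmono
  rw [← hU] at ht
  obtain ⟨m, hm⟩ := (ht.eventually (lt_mem_nhds ha)).exists
  have hm0 : (0 : ℝ) < 1 / ((m : ℝ) + 1) := by positivity
  filter_upwards [Metric.ball_mem_nhds x hm0] with y hy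
  refine lt_of_lt_of_le hm (measure_mono (Metric.ball_subset_ball' ?_))
  rw [dist_comm]
  linarith [Metric.mem_ball.1 hy]

/-- The maximal `k`-dimensional density ratio of a measure. -/
noncomputable def densityRatio (μ : Measure (𝔼 n)) (k : ℝ) (x : 𝔼 n) : ℝ≥0∞ :=
  ⨆ ρ : Set.Ioi (0 : ℝ), μ (Metric.ball x ρ) * (ENNReal.ofReal (ρ : ℝ) ^ k)⁻¹

theorem ofReal_rpow_ne_zero {ρ k : ℝ} (hρ : 0 < ρ) : ENNReal.ofReal ρ ^ k ≠ 0 := by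
  simp [ENNReal.rpow_eq_zero_iff, hρ]

theorem ofReal_rpow_ne_top {ρ k : ℝ} (hρ : 0 < ρ) : ENNReal.ofReal ρ ^ k ≠ ⊤ := by
  simp [ENNReal.rpow_eq_top_iff, hρ]

theorem measurable_densityRatio (μ : Measure (𝔼 n)) (k : ℝ) : Measurable (densityRatio μ k) := by
  refine LowerSemicontinuous.measurable (lowerSemicontinuous_iSup fun ρ => ?_)
  have hc : Continuous fun t : ℝ≥0∞ => t * (ENNReal.ofReal (ρ : ℝ) ^ k)⁻¹ :=
    ENNReal.continuous_mul_const (ENNReal.inv_ne_top.2 (ofReal_rpow_ne_zero ρ.2))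
  exact hc.comp_lowerSemicontinuous (lowerSemicontinuous_measure_ball μ ρ)
    fun a b h => mul_le_mul_left h _

theorem measure_ball_le_densityRatio (μ : Measure (𝔼 n)) (k : ℝ) (x : 𝔼 n) {ρ : ℝ} (hρ : 0 < ρ) :
    μ (Metric.ball x ρ) ≤ densityRatio μ k x * ENNReal.ofReal ρ ^ k := by
  rw [← ENNReal.div_le_iff (ofReal_rpow_ne_zero hρ) (ofReal_rpow_ne_top hρ), div_eq_mul_inv]
  exact le_iSup (fun ρ : Set.Ioi (0 : ℝ) => μ (Metric.ball x ρ) * (ENNReal.ofReal (ρ : ℝ) ^ k)⁻¹)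
    ⟨ρ, hρ⟩

theorem densityRatio_le {μ : Measure (𝔼 n)} {k : ℝ} {x : 𝔼 n} {M : ℝ≥0∞}
    (h : ∀ ρ > 0, μ (Metric.ball x ρ) ≤ M * ENNReal.ofReal ρ ^ k) : densityRatio μ k x ≤ M := by
  refine iSup_le fun ρ => ?_
  rw [← div_eq_mul_inv]
  exact ENNReal.div_le_of_le_mul (h ρ ρ.2)

theorem le_densityRatio {μ : Measure (𝔼 n)} {k : ℝ} {x : 𝔼 n} {c : ℝ≥0∞} {ρ : ℝ} (hρ : 0 < ρ)
    (h : c * ENNReal.ofReal ρ ^ k ≤ μ (Metric.ball x ρ)) : c ≤ densityRatio μ k x := by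
  have := h.trans (measure_ball_le_densityRatio μ k x hρ)
  exact (ENNReal.mul_le_mul_iff_left (ofReal_rpow_ne_zero hρ) (ofReal_rpow_ne_top hρ)).1 this

theorem ofReal_norm_rpow_le_tsum {k R : ℝ} (hk : 1 < k) (hR : 0 < R) (z : 𝔼 n) :
    ENNReal.ofReal (‖z‖ ^ (1 - k)) ≤
      (∑' j : ℕ, (Metric.ball (0 : 𝔼 n) (2 * (R * (1 / 2) ^ j))).indicator
        (fun _ => ENNReal.ofReal ((R * (1 / 2) ^ j / 2) ^ (1 - k))) z) +
      ENNReal.ofReal (R ^ (1 - k)) := by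
  rcases (norm_nonneg z).eq_or_lt with h0 | h0
  · rw [← h0, Real.zero_rpow (by linarith)]
    simp
  rcases le_or_gt R ‖z‖ with hz | hz
  · exact le_add_left (ENNReal.ofReal_le_ofReal
      (Real.rpow_le_rpow_of_nonpos hR hz (by linarith)))
  · obtain ⟨j, hj1, hj2⟩ := exists_nat_pow_near_of_lt_one (div_pos h0 hR)
      ((div_le_one hR).2 hz.le) (y := (1 / 2 : ℝ)) (by norm_num) (by norm_num)
    rw [lt_div_iff₀ hR] at hj1
    rw [div_le_iff₀ hR] at hj2
    refine le_add_right (le_trans ?_ (ENNReal.le_tsum j))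
    rw [Set.indicator_of_mem]
    · refine ENNReal.ofReal_le_ofReal (Real.rpow_le_rpow_of_nonpos (by positivity) ?_
        (by linarith))
      refine le_of_eq_of_le ?_ hj1.le
      ring
    · rw [mem_ball_zero_iff]
      have : 0 < R * (1 / 2) ^ j := by positivity
      linarith [mul_comm R ((1 / 2 : ℝ) ^ j)]

/-- Riesz potential bound for a measure with controlled mass on balls. -/
theorem lintegral_norm_rpow_le {k R : ℝ} (hk : 1 < k) (hR : 0 < R) {ν : Measure (𝔼 n)}
    {y : 𝔼 n} (hν : ∀ s > 0, ν (Metric.ball y s) ≤ ENNReal.ofReal (2 * s) ^ k) :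
    ∫⁻ x, ENNReal.ofReal (‖y - x‖ ^ (1 - k)) ∂ν ≤
      ENNReal.ofReal (8 ^ k * R) + ENNReal.ofReal (R ^ (1 - k)) * ν Set.univ := by
  have hind : ∀ (j : ℕ) (x : 𝔼 n), (Metric.ball (0 : 𝔼 n) (2 * (R * (1 / 2) ^ j))).indicator
        (fun _ => ENNReal.ofReal ((R * (1 / 2) ^ j / 2) ^ (1 - k))) (y - x) =
      (Metric.ball y (2 * (R * (1 / 2) ^ j))).indicator
        (fun _ => ENNReal.ofReal ((R * (1 / 2) ^ j / 2) ^ (1 - k))) x := by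
    intro j x
    simp only [Set.indicator, Metric.mem_ball, dist_eq_norm, norm_sub_rev, sub_zero]
  calc _ ≤ ∫⁻ x, ((∑' j : ℕ, (Metric.ball y (2 * (R * (1 / 2) ^ j))).indicator
        (fun _ => ENNReal.ofReal ((R * (1 / 2) ^ j / 2) ^ (1 - k))) x) +
          ENNReal.ofReal (R ^ (1 - k))) ∂ν := by
        refine lintegral_mono fun x => (ofReal_norm_rpow_le_tsum hk hR (y - x)).trans ?_
        simp only [hind, le_refl]
    _ = (∑' j : ℕ, ENNReal.ofReal ((R * (1 / 2) ^ j / 2) ^ (1 - k)) *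
          ν (Metric.ball y (2 * (R * (1 / 2) ^ j)))) +
          ENNReal.ofReal (R ^ (1 - k)) * ν Set.univ := by
        rw [lintegral_add_right _ measurable_const, lintegral_const, lintegral_tsum]
        · congr 2
          funext j
          rw [lintegral_indicator_const measurableSet_ball]
        · exact fun j => (measurable_const.indicator measurableSet_ball).aemeasurable
    _ ≤ (∑' j : ℕ, ENNReal.ofReal (8 ^ k * R / 2 * (1 / 2) ^ j)) +
          ENNReal.ofReal (R ^ (1 - k)) * ν Set.univ := by
        refine add_le_add_left (ENNReal.tsum_le_tsum fun j => ?_) _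
        have ha : 0 < R * (1 / 2) ^ j := by positivity
        refine (mul_le_mul_right (hν _ (by positivity)) _).trans (le_of_eq ?_)
        rw [ENNReal.ofReal_rpow_of_pos (by positivity), ← ENNReal.ofReal_mul (by positivity)]
        congr 1
        set a := R * (1 / 2) ^ j
        rw [show 2 * (2 * a) = 8 * (a / 2) by ring, Real.mul_rpow (by norm_num) (by positivity)]
        calc _ = 8 ^ k * ((a / 2) ^ (1 - k) * (a / 2) ^ k) := by ring
          _ = 8 ^ k * (a / 2) := by
            rw [← Real.rpow_add (by positivity)]; simp
          _ = _ := by simp only [a]; ring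
    _ = _ := by
        rw [← ENNReal.ofReal_tsum_of_nonneg (fun j => by positivity)
          (summable_geometric_two.mul_left _), tsum_mul_left, tsum_geometric_two]
        congr 2
        ring

/-- Abstract Michael-Simon inequality, weak form. -/
theorem measure_le_of_monotonicity {k : ℝ} (hk : 1 < k) {μ : Measure (𝔼 n)} [IsFiniteMeasure μ]
    {h : (𝔼 n) → ℝ≥0∞} (hh : Measurable h) {G : Set (𝔼 n)} (hG : MeasurableSet G)
    {C c M : ℝ≥0∞} (hC : C ≠ ⊤) (hc : c ≠ 0) (hM : M ≠ ⊤)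
    (hmono : ∀ x ∈ G, ∀ ρ > 0, μ (Metric.ball x ρ) ≤ C * ENNReal.ofReal ρ ^ k *
      ∫⁻ y, ENNReal.ofReal (‖y - x‖ ^ (1 - k)) * h y ∂μ)
    (hlow : ∀ x ∈ G, ∃ ρ > 0, c * ENNReal.ofReal ρ ^ k ≤ μ (Metric.ball x ρ))
    (hup : ∀ x, ∀ ρ > 0, μ (Metric.ball x ρ) ≤ M * ENNReal.ofReal ρ ^ k) :
    μ G ≤ C * (ENNReal.ofReal (8 ^ k) + c⁻¹) * μ Set.univ ^ (1 / k) * ∫⁻ y, h y ∂μ := by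
  rcases eq_or_ne (μ Set.univ) 0 with hA | hA
  · rw [Measure.measure_univ_eq_zero.1 hA]; simp
  set A := μ Set.univ with hAdef
  have hAtop : A ≠ ⊤ := measure_ne_top _ _
  set θ := densityRatio μ k with hθ
  have hθm : Measurable θ := measurable_densityRatio μ k
  have hθc : ∀ x ∈ G, c ≤ θ x := fun x hx => by
    obtain ⟨ρ, hρ, hle⟩ := hlow x hx
    exact le_densityRatio hρ hle
  have hθM : ∀ x, θ x ≤ M := fun x => densityRatio_le (hup x)
  set ν := (μ.restrict G).withDensity fun x => (θ x)⁻¹ with hν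
  have hνball : ∀ y, ∀ s > 0, ν (Metric.ball y s) ≤ ENNReal.ofReal (2 * s) ^ k := by
    intro y s hs
    rw [hν, withDensity_apply _ measurableSet_ball, Measure.restrict_restrict measurableSet_ball]
    have hs2 : (0 : ℝ) < 2 * s := by positivity
    rcases eq_or_ne (μ (Metric.ball y s)) 0 with h0 | h0
    · rw [Measure.restrict_eq_zero.2 (measure_mono_null Set.inter_subset_left h0)]
      simp
    calc _ ≤ ∫⁻ x in Metric.ball y s ∩ G,
          ENNReal.ofReal (2 * s) ^ k * (μ (Metric.ball y s))⁻¹ ∂μ := by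
          refine setLIntegral_mono' (measurableSet_ball.inter hG) fun x hx => ?_
          have hsub : Metric.ball y s ⊆ Metric.ball x (2 * s) := by
            refine Metric.ball_subset_ball' ?_
            have := Metric.mem_ball.1 hx.1
            rw [dist_comm] at this
            linarith
          have := (measure_mono hsub).trans (measure_ball_le_densityRatio μ k x hs2)
          rw [ENNReal.inv_le_iff_inv_le, ENNReal.mul_inv (.inl (ofReal_rpow_ne_zero hs2))
            (.inl (ofReal_rpow_ne_top hs2)), inv_inv, mul_comm, ← div_eq_mul_inv]
          exact ENNReal.div_le_of_le_mul this
      _ ≤ ENNReal.ofReal (2 * s) ^ k * (μ (Metric.ball y s))⁻¹ * μ (Metric.ball y s) := by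
          rw [setLIntegral_const]
          exact mul_le_mul_right (measure_mono Set.inter_subset_left) _
      _ = _ := by
          rw [mul_assoc, ENNReal.inv_mul_cancel h0 (measure_ne_top _ _), mul_one]
  have hνuniv : ν Set.univ ≤ c⁻¹ * A := by
    rw [hν, withDensity_apply _ MeasurableSet.univ, Measure.restrict_univ]
    calc _ ≤ ∫⁻ x in G, c⁻¹ ∂μ := setLIntegral_mono' hG fun x hx => ENNReal.inv_le_inv.2 (hθc x hx)
      _ ≤ _ := by
        rw [setLIntegral_const]
        exact mul_le_mul_right (measure_mono (Set.subset_univ _)) _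
  have hJ : ∀ y, ∫⁻ x, ENNReal.ofReal (‖y - x‖ ^ (1 - k)) ∂ν ≤
      (ENNReal.ofReal (8 ^ k) + c⁻¹) * A ^ (1 / k) := by
    intro y
    have hAr : 0 < A.toReal := ENNReal.toReal_pos hA hAtop
    have hR : 0 < A.toReal ^ (1 / k) := by positivity
    have hRA : ENNReal.ofReal (A.toReal ^ (1 / k)) = A ^ (1 / k) := by
      rw [← ENNReal.ofReal_rpow_of_pos hAr, ENNReal.ofReal_toReal hAtop]
    refine (lintegral_norm_rpow_le hk hR (hνball y)).trans ?_
    rw [add_mul, ENNReal.ofReal_mul (by positivity), hRA]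
    refine add_le_add_right ?_ _
    calc _ ≤ ENNReal.ofReal ((A.toReal ^ (1 / k)) ^ (1 - k)) * (c⁻¹ * A) :=
          mul_le_mul_right hνuniv _
      _ = c⁻¹ * ENNReal.ofReal ((A.toReal ^ (1 / k)) ^ (1 - k) * A.toReal) := by
          rw [ENNReal.ofReal_mul (by positivity), ENNReal.ofReal_toReal hAtop]; ring
      _ = _ := by
          rw [← hRA]
          congr 2
          rw [← Real.rpow_mul hAr.le, ← Real.rpow_add_one hAr.ne']
          congr 1
          field_simp
          ring
  have hKm : Measurable fun z : (𝔼 n) × 𝔼 n => ENNReal.ofReal (‖z.2 - z.1‖ ^ (1 - k)) * h z.2 := by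
    fun_prop
  calc μ G = ∫⁻ x in G, 1 ∂μ := by rw [setLIntegral_one]
    _ ≤ ∫⁻ x in G, (θ x)⁻¹ * (C * ∫⁻ y, ENNReal.ofReal (‖y - x‖ ^ (1 - k)) * h y ∂μ) ∂μ := by
        refine setLIntegral_mono' hG fun x hx => ?_
        rw [← ENNReal.inv_mul_cancel (a := θ x) (ne_of_gt ((pos_iff_ne_zero.2 hc).trans_le
          (hθc x hx))) (ne_top_of_le_ne_top hM (hθM x))]
        refine mul_le_mul_right (densityRatio_le fun ρ hρ => (hmono x hx ρ hρ).trans_eq ?_) _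
        ring
    _ = C * ∫⁻ x, ∫⁻ y, ENNReal.ofReal (‖y - x‖ ^ (1 - k)) * h y ∂μ ∂ν := by
        have hint : Measurable fun x => ∫⁻ y, ENNReal.ofReal (‖y - x‖ ^ (1 - k)) * h y ∂μ :=
          hKm.lintegral_prod_right'
        rw [hν, lintegral_withDensity_eq_lintegral_mul _ hθm.fun_inv hint,
          ← lintegral_const_mul' _ _ hC]
        refine lintegral_congr fun x => ?_
        simp only [Pi.mul_apply]
        ring
    _ = C * ∫⁻ y, (∫⁻ x, ENNReal.ofReal (‖y - x‖ ^ (1 - k)) ∂ν) * h y ∂μ := by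
        have : SFinite ν := by rw [hν]; infer_instance
        rw [lintegral_lintegral_swap hKm.aemeasurable]
        congr 2
        funext y
        rw [lintegral_mul_const]
        fun_prop
    _ ≤ C * ∫⁻ y, ((ENNReal.ofReal (8 ^ k) + c⁻¹) * A ^ (1 / k)) * h y ∂μ :=
        mul_le_mul_right (lintegral_mono fun y => mul_le_mul_left (hJ y) _) _
    _ = _ := by
        rw [lintegral_const_mul _ hh]
        ring

end MichaelSimon

section LowerDensity

variable {n : ℕ}

open scoped RealInnerProductSpace

theorem hasDerivAt_max_zero_sq (s : ℝ) : HasDerivAt (fun s : ℝ => max s 0 ^ 2) (2 * max s 0) s := by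
  have hne : ∀ y : ℝ, y ≠ 0 → HasDerivAt (fun s : ℝ => max s 0 ^ 2) (2 * max y 0) y := by
    intro y hy
    rcases lt_or_gt_of_ne hy with h | h
    · rw [max_eq_right h.le, mul_zero]
      refine (hasDerivAt_const y (0 : ℝ)).congr_of_eventuallyEq ?_
      filter_upwards [gt_mem_nhds h] with z hz
      rw [max_eq_right hz.le]; norm_num
    · rw [max_eq_left h.le]
      have := hasDerivAt_pow 2 y
      refine HasDerivAt.congr_of_eventuallyEq (by simpa using this) ?_
      filter_upwards [lt_mem_nhds h] with z hz
      rw [max_eq_left hz.le]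
  rcases eq_or_ne s 0 with rfl | h
  · exact hasDerivAt_of_hasDerivAt_of_ne (fun y hy => hne y hy) (by fun_prop) (by fun_prop)
  · exact hne s h

theorem continuous_of_hasDerivAt {Φ ψ : ℝ → ℝ} (h : ∀ s, HasDerivAt Φ (ψ s) s) : Continuous Φ :=
  continuous_iff_continuousAt.2 fun s => (h s).continuousAt

/-- Lower bound for the weighted mass of level sets near a point where the function is almost
affine. -/
theorem le_integral_ball_of_almost_affine {w : (𝔼 n) → ℝ} (hw : ContDiff ℝ 1 w) {x ν : 𝔼 n}
    (hν : ‖ν‖ = 1) {ρ : ℝ} (hρ : 0 < ρ) {ψ Φ : ℝ → ℝ} (hψ : Continuous ψ) (hψ0 : ∀ s, 0 ≤ ψ s)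
    (hΦ : ∀ s, HasDerivAt Φ (ψ s) s) {c ε : ℝ} (hε : ε = (1 / 4) ^ n / 32)
    (hΦ0 : ∀ s, 0 ≤ Φ s) (hΦc : ∀ s, Φ s ≤ c)
    (hpos : ∀ y ∈ Metric.ball x ρ, ε * ρ < ⟪y - x, ν⟫ → Φ (w y) = c)
    (hneg : ∀ y ∈ Metric.ball x ρ, ⟪y - x, ν⟫ < -(ε * ρ) → Φ (w y) = 0) :
    3 / 16 * (1 / 4) ^ n * volume.real (Metric.ball (0 : 𝔼 n) 1) * c * ρ ^ n ≤
      ρ * ∫ y in Metric.ball x ρ, ψ (w y) * ‖gradient w y‖ := by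
  have hc0 : 0 ≤ c := (hΦ0 0).trans (hΦc 0)
  have hΦcont := continuous_of_hasDerivAt hΦ
  have hwg : Continuous (gradient w) :=
    (InnerProductSpace.toDual ℝ (𝔼 n)).symm.continuous.comp (hw.continuous_fderiv one_ne_zero)
  have hε0 : 0 < ε := by rw [hε]; positivity
  have hε1 : ε ≤ 1 / 32 := by
    rw [hε]
    have : ((1 : ℝ) / 4) ^ n ≤ 1 := pow_le_one₀ (by norm_num) (by norm_num)
    linarith
  set m : (𝔼 n) → ℝ := fun y => max (1 - ‖y - x‖ ^ 2 / ρ ^ 2) 0 with hm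
  have hmc : Continuous m := by fun_prop
  have hm0 : ∀ y, 0 ≤ m y := fun y => le_max_right _ _
  have hm1 : ∀ y, m y ≤ 1 := fun y => max_le (by
    have : 0 ≤ ‖y - x‖ ^ 2 / ρ ^ 2 := by positivity
    linarith) zero_le_one
  have hmout : ∀ y, y ∉ Metric.ball x ρ → m y = 0 := by
    intro y hy
    rw [Metric.mem_ball, dist_eq_norm, not_lt] at hy
    refine max_eq_right ?_
    have : 1 ≤ ‖y - x‖ ^ 2 / ρ ^ 2 := by
      rw [le_div_iff₀ (by positivity)]
      nlinarith
    linarith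
  have hηd : ∀ y, HasFDerivAt (fun y => m y ^ 2)
      ((2 * m y) • (-(2 / ρ ^ 2) • innerSL ℝ (y - x))) y := by
    intro y
    refine (hasDerivAt_max_zero_sq _).comp_hasFDerivAt (f := fun y => 1 - ‖y - x‖ ^ 2 / ρ ^ 2) y ?_
    have h1 := (((hasFDerivAt_id y).sub_const x).norm_sq.mul_const (ρ ^ 2)⁻¹).const_sub 1
    refine h1.congr_fderiv ?_
    ext z
    simp
    ring
  have hfd : ∀ y, HasFDerivAt (fun y => Φ (w y) * m y ^ 2)
      (Φ (w y) • ((2 * m y) • (-(2 / ρ ^ 2) • innerSL ℝ (y - x))) +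
        m y ^ 2 • (ψ (w y) • fderiv ℝ w y)) y := fun y =>
    ((hΦ (w y)).comp_hasFDerivAt y (hw.differentiable one_ne_zero y).hasFDerivAt).mul (hηd y)
  have hfC : ContDiff ℝ 1 fun y => Φ (w y) * m y ^ 2 := by
    rw [contDiff_one_iff_fderiv]
    refine ⟨fun y => (hfd y).differentiableAt, ?_⟩
    have : fderiv ℝ (fun y => Φ (w y) * m y ^ 2) = _ := funext fun y => (hfd y).fderiv
    rw [this]
    have h1 := hw.continuous_fderiv one_ne_zero
    have h2 := hw.continuous
    fun_prop
  have hsupp : ∀ {F : (𝔼 n) → ℝ}, (∀ y, y ∉ Metric.ball x ρ → F y = 0) → HasCompactSupport F :=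
    fun hF => HasCompactSupport.intro (isCompact_closedBall x ρ) fun y hy =>
      hF y fun h => hy (Metric.ball_subset_closedBall h)
  have hzero := integral_fderiv_eq_zero hfC (hsupp fun y hy => by simp [hmout y hy]) ν
  have hi1 : Integrable fun y => ψ (w y) * ⟪gradient w y, ν⟫ * m y ^ 2 := by
    refine Continuous.integrable_of_hasCompactSupport ?_ (hsupp fun y hy => by simp [hmout y hy])
    have h2 := hw.continuous
    fun_prop
  have hi2 : Integrable fun y => 4 / ρ ^ 2 * (Φ (w y) * m y * ⟪y - x, ν⟫) := by
    refine Continuous.integrable_of_hasCompactSupport ?_ (hsupp fun y hy => by simp [hmout y hy])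
    have h2 := hw.continuous
    fun_prop
  have heq : ∫ y, ψ (w y) * ⟪gradient w y, ν⟫ * m y ^ 2 =
      ∫ y, 4 / ρ ^ 2 * (Φ (w y) * m y * ⟪y - x, ν⟫) := by
    rw [← sub_eq_zero, ← integral_sub hi1 hi2, ← hzero]
    refine integral_congr_ae (.of_forall fun y => ?_)
    simp only [(hfd y).fderiv, add_apply, smul_apply, innerSL_apply_apply, smul_eq_mul,
      inner_gradient_left]
    ring
  have hupper : ∫ y, ψ (w y) * ⟪gradient w y, ν⟫ * m y ^ 2 ≤
      ∫ y in Metric.ball x ρ, ψ (w y) * ‖gradient w y‖ := by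
    rw [← integral_indicator measurableSet_ball]
    refine integral_mono hi1 ?_ fun y => ?_
    · refine IntegrableOn.integrable_indicator ?_ measurableSet_ball
      refine (Continuous.continuousOn ?_).integrableOn_compact
        (isCompact_closedBall x ρ) |>.mono_set Metric.ball_subset_closedBall
      have h2 := hw.continuous
      fun_prop
    · by_cases hy : y ∈ Metric.ball x ρ
      · simp only [Set.indicator_of_mem hy]
        have h1 : ⟪gradient w y, ν⟫ ≤ ‖gradient w y‖ := by
          have := real_inner_le_norm (gradient w y) ν
          rwa [hν, mul_one] at this
        have h2 : m y ^ 2 ≤ 1 := pow_le_one₀ (hm0 y) (hm1 y)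
        calc _ ≤ ψ (w y) * ‖gradient w y‖ * m y ^ 2 := by
              have := hψ0 (w y)
              gcongr
          _ ≤ _ := mul_le_of_le_one_right (mul_nonneg (hψ0 _) (norm_nonneg _)) h2
      · simp [Set.indicator_of_notMem hy, hmout y hy]
  set x' := x + (ρ / 2) • ν with hx'
  have hB' : ∀ y ∈ Metric.ball x' (ρ / 4), ρ / 4 ≤ ⟪y - x, ν⟫ ∧ 7 / 16 ≤ m y ∧
      y ∈ Metric.ball x ρ := by
    intro y hy
    rw [Metric.mem_ball, dist_eq_norm] at hy
    have hyx : y - x = (y - x') + (ρ / 2) • ν := by rw [hx']; abel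
    have hn2 : ‖(ρ / 2) • ν‖ = ρ / 2 := by
      rw [norm_smul, hν, mul_one, Real.norm_of_nonneg (by positivity)]
    have hn1 : ‖y - x‖ ≤ 3 / 4 * ρ := by
      rw [hyx]
      refine (norm_add_le _ _).trans ?_
      rw [hn2]; linarith
    refine ⟨?_, ?_, ?_⟩
    · rw [hyx, inner_add_left, real_inner_smul_left, real_inner_self_eq_norm_sq, hν]
      have := neg_le_of_abs_le (abs_real_inner_le_norm (y - x') ν)
      rw [hν] at this
      linarith
    · refine le_max_of_le_left ?_
      have : ‖y - x‖ ^ 2 / ρ ^ 2 ≤ 9 / 16 := by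
        rw [div_le_iff₀ (by positivity)]
        nlinarith [norm_nonneg (y - x)]
      linarith
    · rw [Metric.mem_ball, dist_eq_norm]; linarith
  have hpt : ∀ y, (Metric.ball x' (ρ / 4)).indicator (fun _ => 4 / ρ ^ 2 * (c * (7 / 64 * ρ))) y -
      (Metric.ball x ρ).indicator (fun _ => 4 / ρ ^ 2 * (c * (2 * ε * ρ))) y ≤
      4 / ρ ^ 2 * (Φ (w y) * m y * ⟪y - x, ν⟫) := by
    intro y
    by_cases hy : y ∈ Metric.ball x ρ
    swap
    · rw [Set.indicator_of_notMem hy, Set.indicator_of_notMem fun h => hy (hB' y h).2.2, hmout y hy]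
      simp
    have hερ : 0 < ε * ρ := by positivity
    have hsm : ε * ρ < ρ / 4 := by nlinarith
    rw [Set.indicator_of_mem hy]
    rcases lt_or_ge (ε * ρ) ⟪y - x, ν⟫ with h1 | h1
    · rw [hpos y hy h1]
      by_cases hyB : y ∈ Metric.ball x' (ρ / 4)
      · rw [Set.indicator_of_mem hyB, ← mul_sub, ← mul_sub]
        obtain ⟨h2, h3, -⟩ := hB' y hyB
        rw [mul_assoc c]
        have : 7 / 64 * ρ ≤ m y * ⟪y - x, ν⟫ := by
          calc _ = 7 / 16 * (ρ / 4) := by ring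
            _ ≤ _ := by gcongr
        have : 7 / 64 * ρ - 2 * ε * ρ ≤ m y * ⟪y - x, ν⟫ := by linarith
        gcongr
      · rw [Set.indicator_of_notMem hyB]
        have h2 : 0 ≤ 4 / ρ ^ 2 * (c * (2 * ε * ρ)) := by positivity
        have h3 : 0 ≤ 4 / ρ ^ 2 * (c * m y * ⟪y - x, ν⟫) := by
          have := hm0 y
          have := hερ.le.trans h1.le
          positivity
        linarith
    · rw [Set.indicator_of_notMem fun h => by linarith [(hB' y h).1], zero_sub, ← mul_neg]
      refine mul_le_mul_of_nonneg_left ?_ (by positivity)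
      rcases lt_or_ge ⟪y - x, ν⟫ (-(ε * ρ)) with h2 | h2
      · rw [hneg y hy h2]
        have : 0 ≤ c * (2 * ε * ρ) := by positivity
        linarith
      · have h3 : |⟪y - x, ν⟫| ≤ ε * ρ := abs_le.2 ⟨h2, h1⟩
        have h4 : |Φ (w y) * m y * ⟪y - x, ν⟫| ≤ c * 1 * (ε * ρ) := by
          rw [abs_mul, abs_mul, abs_of_nonneg (hΦ0 _), abs_of_nonneg (hm0 y)]
          have := hΦ0 (w y)
          have := hm0 y
          gcongr
          · exact hΦc _
          · exact hm1 y
        have h5 : 0 ≤ c * (ε * ρ) := by positivity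
        linarith [neg_le_of_abs_le h4]
  have hball : ∀ (z : 𝔼 n) (s a : ℝ),
      Integrable ((Metric.ball z s).indicator fun _ => a) := fun z s a =>
    (integrable_indicator_iff measurableSet_ball).2
      (integrableOn_const measure_ball_lt_top.ne (by simp))
  have hlow := integral_mono ((hball x' (ρ / 4) _).sub (hball x ρ _)) hi2 hpt
  have hvol : ∀ (z : 𝔼 n) {s : ℝ}, 0 < s → volume.real (Metric.ball z s) =
      s ^ n * volume.real (Metric.ball (0 : 𝔼 n) 1) := by
    intro z s hs
    rw [measureReal_def, Measure.addHaar_ball_of_pos _ _ hs, ENNReal.toReal_mul,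
      ENNReal.toReal_ofReal (by positivity), finrank_euclideanSpace_fin, measureReal_def]
  rw [integral_sub' (hball _ _ _) (hball _ _ _), integral_indicator_const _ measurableSet_ball,
    integral_indicator_const _ measurableSet_ball, hvol x' (by positivity), hvol x hρ] at hlow
  have hfin := (hlow.trans_eq heq.symm).trans hupper
  refine le_trans (le_of_eq ?_) (mul_le_mul_of_nonneg_left hfin hρ.le)
  rw [hε]
  simp only [smul_eq_mul]
  have : (ρ / 4) ^ n = ρ ^ n * (1 / 4) ^ n := by rw [← mul_pow]; ring
  rw [this]
  field_simp
  ring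

end LowerDensity

section LevelBump

/-- `ψ` is a bump of height `h⁻¹` around the level `t` and `Φ` its primitive, which increases
from `0` to `c ≥ 1`. -/
structure IsLevelBump (t h : ℝ) (ψ Φ : ℝ → ℝ) (c : ℝ) : Prop where
  contDiff : ContDiff ℝ 1 ψ
  nonneg : ∀ s, 0 ≤ ψ s
  le_inv : ∀ s, ψ s ≤ h⁻¹
  eq_zero : ∀ s, h ≤ |s - t| → ψ s = 0
  eq_inv : ∀ s, |s - t| ≤ h / 2 → ψ s = h⁻¹
  hasDerivAt : ∀ s, HasDerivAt Φ (ψ s) s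
  primitive_left : ∀ s ≤ t - h, Φ s = 0
  primitive_right : ∀ s, t + h ≤ s → Φ s = c
  primitive_nonneg : ∀ s, 0 ≤ Φ s
  primitive_le : ∀ s, Φ s ≤ c
  one_le : 1 ≤ c

theorem exists_isLevelBump (t : ℝ) {h : ℝ} (hh : 0 < h) : ∃ ψ Φ c, IsLevelBump t h ψ Φ c := by
  let b : ContDiffBump t := ⟨h / 2, h, by positivity, by linarith⟩
  set ψ : ℝ → ℝ := fun s => h⁻¹ * b s with hψ
  have hb : ContDiff ℝ 1 ψ := contDiff_const.mul b.contDiff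
  have hψ0 : ∀ s, 0 ≤ ψ s := fun s => mul_nonneg (by positivity) b.nonneg
  have hzero : ∀ s, h ≤ |s - t| → ψ s = 0 := fun s hs => by
    simp only [hψ]
    rw [b.zero_of_le_dist (by rwa [Real.dist_eq]), mul_zero]
  have hone : ∀ s, |s - t| ≤ h / 2 → ψ s = h⁻¹ := fun s hs => by
    simp only [hψ]
    rw [b.one_of_mem_closedBall (by rwa [Metric.mem_closedBall, Real.dist_eq]), mul_one]
  have hint : ∀ a b, IntervalIntegrable ψ volume a b := fun a b =>
    hb.continuous.intervalIntegrable a b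
  set Φ : ℝ → ℝ := fun s => ∫ u in (t - h)..s, ψ u with hΦ
  have hmono : Monotone Φ := fun a b hab => by
    rw [← sub_nonneg]
    simp only [hΦ]
    rw [intervalIntegral.integral_interval_sub_left (hint _ _) (hint _ _)]
    exact intervalIntegral.integral_nonneg hab fun u _ => hψ0 u
  have hright : ∀ s, t + h ≤ s → Φ s = Φ (t + h) := fun s hs => by
    rw [← sub_eq_zero]
    simp only [hΦ]
    rw [intervalIntegral.integral_interval_sub_left (hint _ _) (hint _ _)]
    refine (intervalIntegral.integral_congr (g := fun _ => 0) fun u hu => ?_).trans (by simp)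
    rw [Set.uIcc_of_le hs] at hu
    exact hzero u (le_abs.2 (.inl (by linarith [hu.1])))
  have hleft : ∀ s ≤ t - h, Φ s = 0 := fun s hs => by
    simp only [hΦ]
    refine (intervalIntegral.integral_congr (g := fun _ => 0) fun u hu => ?_).trans (by simp)
    rw [Set.uIcc_of_ge hs] at hu
    exact hzero u (le_abs.2 (.inr (by linarith [hu.2])))
  have hnn : ∀ s, 0 ≤ Φ s := fun s => by
    rcases le_total s (t - h) with hs | hs
    · rw [hleft s hs]
    · rw [← hleft _ le_rfl]; exact hmono hs
  refine ⟨ψ, Φ, Φ (t + h), hb, hψ0, fun s => mul_le_of_le_one_right (by positivity) b.le_one,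
    hzero, hone, fun s => hb.continuous.integral_hasStrictDerivAt _ _ |>.hasDerivAt, hleft, hright,
    hnn, fun s => ?_, ?_⟩
  · rcases le_total s (t + h) with hs | hs
    · exact hmono hs
    · exact (hright s hs).le
  · have h1 : Φ (t + h / 2) - Φ (t - h / 2) = 1 := by
      simp only [hΦ]
      rw [intervalIntegral.integral_interval_sub_left (hint _ _) (hint _ _)]
      refine (intervalIntegral.integral_congr (g := fun _ => h⁻¹) fun u hu => ?_).trans ?_
      · rw [Set.uIcc_of_le (by linarith)] at hu
        exact hone u (abs_le.2 ⟨by linarith [hu.1], by linarith [hu.2]⟩)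
      · simp
        field_simp
    have h2 := hmono (show t + h / 2 ≤ t + h by linarith)
    linarith [hnn (t - h / 2)]

variable {n : ℕ}

open scoped RealInnerProductSpace

/-- The weighted measure concentrated near the level `t` of `|v|`. -/
noncomputable def levelMeasure (Ω : Set (𝔼 n)) (v : (𝔼 n) → ℝ) (ψ : ℝ → ℝ) : Measure (𝔼 n) :=
  volume.withDensity fun y =>
    ENNReal.ofReal (Ω.indicator (fun y => ψ |v y|) y * ‖gradient v y‖)

/-- The lower density constant of level sets. -/
noncomputable def densityConst (n : ℕ) : ℝ :=
  3 / 16 * (1 / 4) ^ n * volume.real (Metric.ball (0 : 𝔼 n) 1)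

theorem densityConst_pos (n : ℕ) : 0 < densityConst n := by
  have : 0 < volume.real (Metric.ball (0 : 𝔼 n) 1) :=
    ENNReal.toReal_pos (Metric.measure_ball_pos _ _ one_pos).ne' measure_ball_lt_top.ne
  unfold densityConst
  positivity

theorem exists_lower_density {Ω : Set (𝔼 n)} (hΩ : IsOpen Ω) (hb : IsBounded Ω)
    {v : (𝔼 n) → ℝ} (hv : ContDiff ℝ 1 v) (hv0 : ∀ x ∈ frontier Ω, v x = 0) {t δ : ℝ}
    (ht : 0 < t) (hδ : 0 < δ) :
    ∃ ρ > 0, ∃ h₀ > 0, ∀ h, 0 < h → h < h₀ → ∀ ψ Φ c, IsLevelBump t h ψ Φ c →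
      ∀ x ∈ Ω, |(|v x| - t)| ≤ h / 2 → δ ≤ ‖gradient v x‖ →
      ENNReal.ofReal (densityConst n) * ENNReal.ofReal ρ ^ ((n : ℝ) - 1) ≤
        levelMeasure Ω v ψ (Metric.ball x ρ) := by
  set ε : ℝ := (1 / 4) ^ n / 32 with hε
  have hε0 : 0 < ε := by positivity
  have hK := isCompact_closure_inter_le_abs hb hv.continuous (t / 2)
  obtain ⟨r, hr, hrΩ⟩ := hK.exists_cthickening_subset_open hΩ
    (closure_inter_le_abs_subset hΩ hv0 (by positivity : 0 < t / 2))
  have hK1 := hK.cthickening (r := r)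
  have huc := hK1.uniformContinuousOn_of_continuous
    (hv.continuous_fderiv one_ne_zero).continuousOn
  obtain ⟨ρ', hρ', hmod⟩ := Metric.uniformContinuousOn_iff.1 huc (ε / 2 * δ) (by positivity)
  set ρ := min r ρ' with hρ
  have hρ0 : 0 < ρ := lt_min hr hρ'
  refine ⟨ρ, hρ0, min t (δ * ρ * ε / 3), lt_min ht (by positivity), ?_⟩
  intro h hh hh0 ψ Φ c hB x hxΩ hxt hxδ
  have hht : h < t := hh0.trans_le (min_le_left _ _)
  have hhρ : h < δ * ρ * ε / 3 := hh0.trans_le (min_le_right _ _)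
  have hxt' := abs_le.1 hxt
  have hxK : x ∈ closure Ω ∩ {x | t / 2 ≤ |v x|} := ⟨subset_closure hxΩ, by
    rw [Set.mem_ofPred_eq]; linarith [hxt'.1]⟩
  have hsub : Metric.ball x ρ ⊆ Metric.cthickening r (closure Ω ∩ {x | t / 2 ≤ |v x|}) :=
    (Metric.ball_subset_closedBall.trans (Metric.closedBall_subset_closedBall (min_le_left _ _))).trans
      (Metric.closedBall_subset_cthickening hxK r)
  have hmv : ∀ y ∈ Metric.ball x ρ,
      |v y - v x - ⟪gradient v x, y - x⟫| ≤ ε / 2 * δ * ρ := by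
    intro y hy
    have h1 := (convex_ball x ρ).norm_image_sub_le_of_norm_hasFDerivWithin_le' (f := v)
      (f' := fderiv ℝ v) (φ := fderiv ℝ v x) (C := ε / 2 * δ)
      (fun z _ => (hv.differentiable one_ne_zero z).hasFDerivAt.hasFDerivWithinAt)
      (fun z hz => by
        rw [← dist_eq_norm]
        refine (hmod z (hsub hz) x (hsub (Metric.mem_ball_self hρ0)) ?_).le
        exact (Metric.mem_ball.1 hz).trans_le (min_le_right _ _))
      (Metric.mem_ball_self hρ0) hy
    rw [inner_gradient_left, ← Real.norm_eq_abs]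
    refine h1.trans ?_
    rw [Metric.mem_ball, dist_eq_norm] at hy
    gcongr
  obtain ⟨σ, hσ, hσv⟩ : ∃ σ : ℝ, |σ| = 1 ∧ σ * v x = |v x| := by
    rcases le_total 0 (v x) with h | h
    · exact ⟨1, by simp, by rw [abs_of_nonneg h, one_mul]⟩
    · exact ⟨-1, by simp, by rw [abs_of_nonpos h]; ring⟩
  have hσσ : σ * σ = 1 := by rw [← abs_mul_abs_self, hσ, one_mul]
  set d := ‖gradient v x‖ with hd
  have hd0 : 0 < d := hδ.trans_le hxδ
  set ν := (σ * d⁻¹) • gradient v x with hν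
  have hν1 : ‖ν‖ = 1 := by
    rw [hν, norm_smul, norm_mul, Real.norm_eq_abs σ, hσ, norm_inv, hd, norm_norm, one_mul,
      inv_mul_cancel₀ hd0.ne']
  have hνi : ∀ y, σ * ⟪gradient v x, y - x⟫ = d * ⟪y - x, ν⟫ := by
    intro y
    rw [hν, inner_smul_right, real_inner_comm]
    field_simp
  have haff : ∀ y ∈ Metric.ball x ρ, |σ * v y - |v x| - d * ⟪y - x, ν⟫| ≤ ε / 2 * δ * ρ := by
    intro y hy
    rw [← hνi, ← hσv, ← mul_sub, ← mul_sub, abs_mul, hσ, one_mul]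
    exact hmv y hy
  have hdδ : δ * (ε * ρ) ≤ d * (ε * ρ) := by gcongr
  have hgrad : ∀ y, ‖gradient (fun z => σ * v z) y‖ = ‖gradient v y‖ := by
    intro y
    have : fderiv ℝ (fun z => σ * v z) y = σ • fderiv ℝ v y :=
      fderiv_const_mul (hv.differentiable one_ne_zero y) σ
    rw [gradient, gradient, this, map_smulₛₗ, norm_smul]
    simp [hσ]
  have hvg : Continuous (gradient v) :=
    (InnerProductSpace.toDual ℝ (𝔼 n)).symm.continuous.comp (hv.continuous_fderiv one_ne_zero)
  have main := le_integral_ball_of_almost_affine (w := fun y => σ * v y) (x := x) (ν := ν)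
    (contDiff_const.mul hv) hν1 hρ0 hB.contDiff.continuous hB.nonneg hB.hasDerivAt hε
    hB.primitive_nonneg hB.primitive_le
    (fun y hy hy' => hB.primitive_right _ (by
      have h1 := (abs_le.1 (haff y hy)).1
      have h2 := mul_lt_mul_of_pos_left hy' hd0
      nlinarith [hxt'.1]))
    (fun y hy hy' => hB.primitive_left _ (by
      have h1 := (abs_le.1 (haff y hy)).2
      have h2 := mul_lt_mul_of_pos_left hy' hd0
      nlinarith [hxt'.2]))
  simp only [hgrad] at main
  have hreal : densityConst n * ρ ^ ((n : ℝ) - 1) ≤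
      ∫ y in Metric.ball x ρ, ψ (σ * v y) * ‖gradient v y‖ := by
    have h1 : ρ ^ n = ρ * ρ ^ ((n : ℝ) - 1) := by
      rw [Real.rpow_sub_one hρ0.ne', Real.rpow_natCast]; field_simp
    have h2 : densityConst n * ρ ^ n ≤ densityConst n * c * ρ ^ n := by
      have := (densityConst_pos n).le
      have := hB.one_le
      rw [mul_right_comm]
      exact le_mul_of_one_le_right (by positivity) this
    have h3 := h2.trans main
    rw [h1] at h3
    refine le_of_mul_le_mul_left (le_trans (le_of_eq ?_) h3) hρ0
    ring
  have hcont : Continuous fun y => ψ (σ * v y) * ‖gradient v y‖ := by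
    have h1 := hB.contDiff.continuous
    have h2 := hv.continuous
    fun_prop
  rw [ENNReal.ofReal_rpow_of_pos hρ0, ← ENNReal.ofReal_mul (densityConst_pos n).le, levelMeasure,
    withDensity_apply _ measurableSet_ball]
  refine (ENNReal.ofReal_le_ofReal hreal).trans ?_
  rw [ofReal_integral_eq_lintegral_ofReal
    ((hcont.continuousOn.integrableOn_compact (isCompact_closedBall x ρ)).mono_set
      Metric.ball_subset_closedBall)
    (.of_forall fun y => mul_nonneg (hB.nonneg _) (norm_nonneg _))]
  refine setLIntegral_mono' measurableSet_ball fun y hy => ENNReal.ofReal_le_ofReal ?_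
  rw [Set.indicator_of_mem (hrΩ (hsub hy))]
  refine mul_le_mul_of_nonneg_right ?_ (norm_nonneg _)
  rcases le_or_gt (σ * v y) 0 with h1 | h1
  · rw [hB.eq_zero _ (le_abs.2 (.inr (by linarith)))]
    exact hB.nonneg _
  · rw [← abs_of_pos h1, abs_mul, hσ, one_mul]

end LevelBump

section LevelEstimates

variable {n : ℕ}

open scoped RealInnerProductSpace

theorem continuous_gradient {v : (𝔼 n) → ℝ} (hv : ContDiff ℝ 1 v) : Continuous (gradient v) :=
  (InnerProductSpace.toDual ℝ (𝔼 n)).symm.continuous.comp (hv.continuous_fderiv one_ne_zero)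

/-- The push-forward of `f |∇v| dx` on `Ω` under `|v|`. -/
noncomputable def levelMass (Ω : Set (𝔼 n)) (v : (𝔼 n) → ℝ) (f : (𝔼 n) → ℝ≥0∞) : Measure ℝ :=
  ((volume.restrict Ω).withDensity fun y => f y * ENNReal.ofReal ‖gradient v y‖).map fun y => |v y|

theorem levelMass_apply {Ω : Set (𝔼 n)} {v : (𝔼 n) → ℝ} (hv : Continuous v)
    (f : (𝔼 n) → ℝ≥0∞) {S : Set ℝ} (hS : MeasurableSet S) :
    levelMass Ω v f S =
      ∫⁻ y in {y | |v y| ∈ S} ∩ Ω, f y * ENNReal.ofReal ‖gradient v y‖ := by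
  have hm : MeasurableSet {y | |v y| ∈ S} := hv.abs.measurable hS
  rw [levelMass, Measure.map_apply hv.abs.measurable hS, withDensity_apply _ (hv.abs.measurable hS),
    Measure.restrict_restrict (hv.abs.measurable hS)]
  rfl

theorem measurable_levelDensity {Ω : Set (𝔼 n)} (hΩ : IsOpen Ω) {v : (𝔼 n) → ℝ}
    (hv : ContDiff ℝ 1 v) {ψ : ℝ → ℝ} (hψ : Continuous ψ) : Measurable fun y =>
    ENNReal.ofReal (Ω.indicator (fun y => ψ |v y|) y * ‖gradient v y‖) := by
  have h1 : Measurable (Ω.indicator fun y => ψ |v y|) :=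
    (hψ.comp hv.continuous.abs).measurable.indicator hΩ.measurableSet
  exact (h1.mul (continuous_gradient hv).measurable.norm).ennreal_ofReal

theorem lintegral_levelMeasure_le {Ω : Set (𝔼 n)} (hΩ : IsOpen Ω) {v : (𝔼 n) → ℝ}
    (hv : ContDiff ℝ 1 v) {t h c : ℝ} {ψ Φ : ℝ → ℝ} (hB : IsLevelBump t h ψ Φ c)
    {f : (𝔼 n) → ℝ≥0∞} (hf : Measurable f) :
    ∫⁻ y, f y ∂(levelMeasure Ω v ψ) ≤
      ENNReal.ofReal h⁻¹ * levelMass Ω v f (Metric.closedBall t h) := by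
  have hm : MeasurableSet {y | |v y| ∈ Metric.closedBall t h} :=
    hv.continuous.abs.measurable Metric.isClosed_closedBall.measurableSet
  rw [levelMass_apply hv.continuous f Metric.isClosed_closedBall.measurableSet, levelMeasure,
    lintegral_withDensity_eq_lintegral_mul _
      (measurable_levelDensity hΩ hv hB.contDiff.continuous) hf,
    ← lintegral_const_mul' _ _ ENNReal.ofReal_ne_top,
    ← lintegral_indicator (hm.inter hΩ.measurableSet)]
  refine lintegral_mono fun y => ?_
  simp only [Pi.mul_apply]
  by_cases hy : y ∈ {y | |v y| ∈ Metric.closedBall t h} ∩ Ω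
  · rw [Set.indicator_of_mem hy, Set.indicator_of_mem hy.2, ENNReal.ofReal_mul (hB.nonneg _),
      mul_right_comm, ← mul_assoc, mul_assoc]
    refine (mul_le_mul_left (ENNReal.ofReal_le_ofReal (hB.le_inv _)) _).trans_eq ?_
    ring
  · rw [Set.indicator_of_notMem hy]
    by_cases hyΩ : y ∈ Ω
    · rw [Set.indicator_of_mem hyΩ, hB.eq_zero]
      · simp
      · by_contra h1
        exact hy ⟨by
          rw [Set.mem_ofPred_eq, Metric.mem_closedBall, Real.dist_eq]; exact (not_le.1 h1).le, hyΩ⟩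
    · rw [Set.indicator_of_notMem hyΩ]; simp

theorem le_levelMeasure {Ω : Set (𝔼 n)} (hΩ : IsOpen Ω) {v : (𝔼 n) → ℝ}
    (hv : ContDiff ℝ 1 v) {t h c δ : ℝ} {ψ Φ : ℝ → ℝ} (hB : IsLevelBump t h ψ Φ c) :
    ENNReal.ofReal h⁻¹ * levelMass Ω v ({y | δ ≤ ‖gradient v y‖}.indicator fun _ => 1)
        (Metric.closedBall t (h / 2)) ≤
      levelMeasure Ω v ψ ({y | |v y| ∈ Metric.closedBall t (h / 2)} ∩ Ω ∩
        {y | δ ≤ ‖gradient v y‖}) := by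
  have hm : MeasurableSet {y | |v y| ∈ Metric.closedBall t (h / 2)} :=
    hv.continuous.abs.measurable Metric.isClosed_closedBall.measurableSet
  have hδ : MeasurableSet {y | δ ≤ ‖gradient v y‖} :=
    measurableSet_le measurable_const (continuous_gradient hv).measurable.norm
  rw [levelMass_apply hv.continuous _ Metric.isClosed_closedBall.measurableSet, levelMeasure,
    withDensity_apply _ ((hm.inter hΩ.measurableSet).inter hδ),
    ← lintegral_const_mul' _ _ ENNReal.ofReal_ne_top, ← lintegral_indicator
      (hm.inter hΩ.measurableSet), ← lintegral_indicator ((hm.inter hΩ.measurableSet).inter hδ)]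
  refine lintegral_mono fun y => ?_
  by_cases hy : y ∈ {y | |v y| ∈ Metric.closedBall t (h / 2)} ∩ Ω
  · by_cases hyδ : y ∈ {y | δ ≤ ‖gradient v y‖}
    · simp only [Set.indicator_of_mem hy, Set.indicator_of_mem (Set.mem_inter hy hyδ),
        Set.indicator_of_mem hyδ, Set.indicator_of_mem hy.2]
      have := hy.1
      rw [Set.mem_ofPred_eq, Metric.mem_closedBall, Real.dist_eq] at this
      rw [hB.eq_inv _ this, one_mul]
      rw [ENNReal.ofReal_mul (by rw [← hB.eq_inv _ this]; exact hB.nonneg _)]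
    · simp only [Set.indicator_of_notMem hyδ, Set.indicator_of_mem hy]
      simp
  · rw [Set.indicator_of_notMem hy]
    exact zero_le

theorem isFiniteMeasure_and_growth_levelMeasure {Ω : Set (𝔼 n)} (hΩ : IsOpen Ω)
    (hb : IsBounded Ω) {v : (𝔼 n) → ℝ} (hv : ContDiff ℝ 1 v) {t h c : ℝ} {ψ Φ : ℝ → ℝ}
    (hB : IsLevelBump t h ψ Φ c) (hn : 2 ≤ n) :
    IsFiniteMeasure (levelMeasure Ω v ψ) ∧ ∃ M : ℝ≥0∞, M ≠ ⊤ ∧ ∀ x, ∀ ρ > 0,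
      levelMeasure Ω v ψ (Metric.ball x ρ) ≤ M * ENNReal.ofReal ρ ^ ((n : ℝ) - 1) := by
  have hk : (0 : ℝ) ≤ (n : ℝ) - 1 := by
    have : (2 : ℝ) ≤ n := by exact_mod_cast hn
    linarith
  obtain ⟨L, hL⟩ := hb.isCompact_closure.exists_bound_of_continuousOn
    (f := fun y => ψ |v y| * ‖gradient v y‖)
    ((hB.contDiff.continuous.comp hv.continuous.abs).mul
      (continuous_gradient hv).norm).continuousOn
  have hdens : ∀ S, MeasurableSet S → levelMeasure Ω v ψ S ≤ ENNReal.ofReal L * volume (S ∩ Ω) := by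
    intro S hS
    rw [levelMeasure, withDensity_apply _ hS, ← setLIntegral_const,
      ← lintegral_indicator hS, ← lintegral_indicator (hS.inter hΩ.measurableSet)]
    refine lintegral_mono fun y => ?_
    by_cases hyS : y ∈ S
    · by_cases hyΩ : y ∈ Ω
      · simp only [Set.indicator_of_mem hyS, Set.indicator_of_mem hyΩ,
          Set.indicator_of_mem (Set.mem_inter hyS hyΩ)]
        exact ENNReal.ofReal_le_ofReal ((le_abs_self _).trans (hL y (subset_closure hyΩ)))
      · simp [hyΩ, hyS]
    · simp [hyS]
  have hfin : levelMeasure Ω v ψ Set.univ < ⊤ := by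
    refine (hdens _ MeasurableSet.univ).trans_lt (ENNReal.mul_lt_top ENNReal.ofReal_lt_top ?_)
    rw [Set.univ_inter]
    exact hb.measure_lt_top
  refine ⟨⟨hfin⟩, ENNReal.ofReal L * volume (Metric.ball (0 : 𝔼 n) 1) +
    levelMeasure Ω v ψ Set.univ, ENNReal.add_ne_top.2 ⟨ENNReal.mul_ne_top ENNReal.ofReal_ne_top
      measure_ball_lt_top.ne, hfin.ne⟩, fun x ρ hρ => ?_⟩
  rcases le_total ρ 1 with h1 | h1
  · refine ((hdens _ measurableSet_ball).trans
      (mul_le_mul_right (measure_mono Set.inter_subset_left) _)).trans ?_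
    rw [Measure.addHaar_ball_of_pos _ _ hρ, finrank_euclideanSpace_fin, add_mul]
    refine le_add_right ?_
    rw [mul_assoc, mul_comm (volume _)]
    refine mul_le_mul_right (mul_le_mul_left ?_ _) _
    rw [ENNReal.ofReal_rpow_of_pos hρ, ← Real.rpow_natCast]
    exact ENNReal.ofReal_le_ofReal (Real.rpow_le_rpow_of_exponent_ge hρ h1 (by linarith))
  · rw [add_mul]
    refine le_add_left ((measure_mono (Set.subset_univ _)).trans ?_)
    refine le_mul_of_one_le_right zero_le (ENNReal.one_le_rpow (ENNReal.one_le_ofReal.2 h1) ?_)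
    have : (2 : ℝ) ≤ n := by exact_mod_cast hn
    linarith

/-- The constant in the Michael-Simon inequality. -/
noncomputable def michaelSimonConst (n : ℕ) : ℝ≥0∞ :=
  ENNReal.ofReal (2 ^ (((n : ℝ) - 1) / 2 + 1)) *
    (ENNReal.ofReal (8 ^ ((n : ℝ) - 1)) + (ENNReal.ofReal (densityConst n))⁻¹)

theorem michaelSimonConst_ne_top (n : ℕ) : michaelSimonConst n ≠ ⊤ :=
  ENNReal.mul_ne_top ENNReal.ofReal_ne_top (ENNReal.add_ne_top.2 ⟨ENNReal.ofReal_ne_top,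
    ENNReal.inv_ne_top.2 (by simpa using densityConst_pos n)⟩)

theorem lintegral_le_rpow_mul_measure_univ {α : Type*} [MeasurableSpace α] {μ : Measure α}
    {f : α → ℝ≥0∞} (hf : Measurable f) {r : ℝ} (hr : 1 ≤ r) :
    ∫⁻ y, f y ∂μ ≤ (∫⁻ y, f y ^ r ∂μ) ^ (1 / r) * μ Set.univ ^ (1 - 1 / r) := by
  rcases hr.eq_or_lt with rfl | hr
  · simp
  · have := ENNReal.lintegral_mul_le_Lp_mul_Lq μ (Real.HolderConjugate.conjExponent hr)
      hf.aemeasurable (g := fun _ => 1) aemeasurable_const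
    simpa [Real.conjExponent, sub_div, div_self (by linarith : r ≠ 0)] using this

/-- Michael-Simon inequality for thickened level sets. -/
theorem exists_levelMass_le (hn : 2 < n) {r : ℝ} (hr : 1 ≤ r) {Ω : Set (𝔼 n)} (hΩ : IsOpen Ω)
    (hb : IsBounded Ω) {v : (𝔼 n) → ℝ} (hv : ContDiff ℝ 2 v) (hv0 : ∀ x ∈ frontier Ω, v x = 0)
    {t δ : ℝ} (ht : 0 < t) (hδ : 0 < δ) :
    ∃ h₀ > 0, ∀ h, 0 < h → h < h₀ →
      ENNReal.ofReal h⁻¹ * levelMass Ω v ({y | δ ≤ ‖gradient v y‖}.indicator fun _ => 1)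
        (Metric.closedBall t (h / 2)) ≤
      michaelSimonConst n *
        (ENNReal.ofReal h⁻¹ * levelMass Ω v (fun _ => 1) (Metric.closedBall t h)) ^
          (1 / ((n : ℝ) - 1) + (1 - 1 / r)) *
        (ENNReal.ofReal h⁻¹ * levelMass Ω v (fun y => ENNReal.ofReal |meanCurv v y| ^ r)
          (Metric.closedBall t h)) ^ (1 / r) := by
  have hv1 : ContDiff ℝ 1 v := hv.of_le one_le_two
  obtain ⟨ρ, hρ, h₀, hh₀, hlow⟩ := exists_lower_density hΩ hb hv1 hv0 ht hδ
  refine ⟨min h₀ t, lt_min hh₀ ht, fun h hh hhmin => ?_⟩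
  have hht : h < t := hhmin.trans_le (min_le_right _ _)
  obtain ⟨ψ, Φ, c, hB⟩ := exists_isLevelBump t hh
  obtain ⟨hfin, M, hM, hup⟩ := isFiniteMeasure_and_growth_levelMeasure hΩ hb hv1 hB hn.le
  have hk1 : (1 : ℝ) < (n : ℝ) - 1 := by
    have : (2 : ℝ) < n := by exact_mod_cast hn
    linarith
  have hψz : ∀ s < t - h, ψ s = 0 := fun s hs =>
    hB.eq_zero s (le_abs.2 (.inr (by linarith)))
  have hP : ContDiff ℝ 1 fun s => ψ |s| := contDiff_comp_abs hB.contDiff (sub_pos.2 hht) hψz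
  have hPz : ∀ s, |s| < t - h → ψ |s| = 0 := fun s hs => hψz _ hs
  have hg := contDiff_cutoff hΩ hb hv1 hv0 hP (sub_pos.2 hht) hPz
  have hgc := hasCompactSupport_cutoff hb (v := v) fun s => ψ |s|
  have hgv := hasFDerivAt_cutoff hΩ hb hv1 hv0 hP (sub_pos.2 hht) hPz
  have hHm : Measurable fun y => ENNReal.ofReal |meanCurv v y| :=
    (measurable_meanCurv v).abs.ennreal_ofReal
  set G := {y | |v y| ∈ Metric.closedBall t (h / 2)} ∩ Ω ∩ {y | δ ≤ ‖gradient v y‖} with hG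
  have hGm : MeasurableSet G :=
    ((hv.continuous.abs.measurable Metric.isClosed_closedBall.measurableSet).inter
      hΩ.measurableSet).inter
      (measurableSet_le measurable_const (continuous_gradient hv1).measurable.norm)
  have main := measure_le_of_monotonicity hk1 (μ := levelMeasure Ω v ψ) hHm hGm
    (C := ENNReal.ofReal (2 ^ (((n : ℝ) - 1) / 2 + 1))) (c := ENNReal.ofReal (densityConst n))
    ENNReal.ofReal_ne_top (by simpa using densityConst_pos n) hM
    (fun x _ s hs => withDensity_ball_le hn.le hv hg hgc
      (fun x => Set.indicator_nonneg (fun y _ => hB.nonneg _) x)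
      (fun x => by
        rw [(hgv x).fderiv]
        by_cases hx : x ∈ Ω
        · rw [Set.indicator_of_mem hx]; exact ⟨_, rfl⟩
        · rw [Set.indicator_of_notMem hx]; exact ⟨0, by simp⟩) x hs)
    (fun x hx => ⟨ρ, hρ, hlow h hh (hhmin.trans_le (min_le_left _ _)) ψ Φ c hB x hx.1.2
      (by simpa [Real.dist_eq] using hx.1.1) hx.2⟩) hup
  have huniv : levelMeasure Ω v ψ Set.univ ≤
      ENNReal.ofReal h⁻¹ * levelMass Ω v (fun _ => 1) (Metric.closedBall t h) := by
    rw [← lintegral_one]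
    exact lintegral_levelMeasure_le hΩ hv1 hB measurable_const
  refine (le_levelMeasure hΩ hv1 hB).trans (main.trans ?_)
  have hr1 : 1 / r ≤ 1 := by rw [div_le_one (by linarith)]; exact hr
  have hr0 : 0 ≤ 1 / r := by positivity
  have hk0 : 0 ≤ 1 / ((n : ℝ) - 1) := by
    have : 0 < (n : ℝ) - 1 := by linarith
    positivity
  calc _ ≤ michaelSimonConst n * levelMeasure Ω v ψ Set.univ ^ (1 / ((n : ℝ) - 1)) *
        ((∫⁻ y, ENNReal.ofReal |meanCurv v y| ^ r ∂(levelMeasure Ω v ψ)) ^ (1 / r) *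
          levelMeasure Ω v ψ Set.univ ^ (1 - 1 / r)) :=
        mul_le_mul_right (lintegral_le_rpow_mul_measure_univ hHm hr) _
    _ = michaelSimonConst n *
          levelMeasure Ω v ψ Set.univ ^ (1 / ((n : ℝ) - 1) + (1 - 1 / r)) *
        (∫⁻ y, ENNReal.ofReal |meanCurv v y| ^ r ∂(levelMeasure Ω v ψ)) ^ (1 / r) := by
        rw [ENNReal.rpow_add_of_nonneg _ _ hk0 (by linarith)]
        ring
    _ ≤ _ := by
        gcongr
        exact lintegral_levelMeasure_le hΩ hv1 hB (hHm.pow_const r)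

theorem volume_rpow_le_levelMass (hn : 2 ≤ n) {Ω : Set (𝔼 n)} (hΩ : IsOpen Ω)
    (hb : IsBounded Ω) {v : (𝔼 n) → ℝ} (hv : ContDiff ℝ 1 v) (hv0 : ∀ x ∈ frontier Ω, v x = 0)
    {t h : ℝ} (hh : 0 < h) (hht : h < t) :
    volume (Ω ∩ {x | t + h ≤ |v x|}) ^ (((n : ℝ) - 1) / n) ≤
      eLpNormLESNormFDerivOneConst (volume : Measure (𝔼 n)) (NNReal.conjExponent n) *
        (ENNReal.ofReal h⁻¹ * levelMass Ω v (fun _ => 1) (Metric.closedBall t h)) := by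
  obtain ⟨ψ, Φ, c, hB⟩ := exists_isLevelBump t hh
  have hn1 : (1 : ℝ) < n := by exact_mod_cast hn
  have hΦ : ContDiff ℝ 1 Φ := by
    rw [contDiff_one_iff_deriv]
    refine ⟨fun s => (hB.hasDerivAt s).differentiableAt, ?_⟩
    rw [show deriv Φ = ψ from funext fun s => (hB.hasDerivAt s).deriv]
    exact hB.contDiff.continuous
  have hΦz : ∀ s < t - h, Φ s = 0 := fun s hs => hB.primitive_left s hs.le
  have hP : ContDiff ℝ 1 fun s => Φ |s| := contDiff_comp_abs hΦ (sub_pos.2 hht) hΦz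
  have hPz : ∀ s, |s| < t - h → Φ |s| = 0 := fun s hs => hΦz _ hs
  have hu := contDiff_cutoff hΩ hb hv hv0 hP (sub_pos.2 hht) hPz
  have huc := hasCompactSupport_cutoff hb (v := v) fun s => Φ |s|
  have hud := hasFDerivAt_cutoff hΩ hb hv hv0 hP (sub_pos.2 hht) hPz
  have hPd : ∀ s, |deriv (fun s => Φ |s|) s| ≤ ψ |s| := by
    intro s
    by_cases hs : s = 0
    · have : (fun s => Φ |s|) =ᶠ[𝓝 s] fun _ => 0 := by
        have h1 : ∀ᶠ y in 𝓝 s, |y| < t - h :=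
          continuous_abs.continuousAt.eventually (gt_mem_nhds (by simpa [hs] using hht))
        exact h1.mono fun y hy => hPz _ hy
      rw [this.deriv_eq]
      simpa using hB.nonneg _
    · have := (hB.hasDerivAt |s|).comp s (hasDerivAt_abs hs)
      rw [show deriv (fun s => Φ |s|) s = _ from this.deriv, abs_mul, abs_of_nonneg (hB.nonneg _)]
      refine mul_le_of_le_one_right (hB.nonneg _) ?_
      rcases lt_or_gt_of_ne hs with h | h <;> simp [h]
  have hn1' : (1 : NNReal) < n := by exact_mod_cast hn
  have hconj := NNReal.HolderConjugate.conjExponent hn1'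
  have hconj' : NNReal.HolderConjugate (Module.finrank ℝ (𝔼 n)) (NNReal.conjExponent n) := by
    rw [finrank_euclideanSpace_fin]; exact hconj
  have hp : (NNReal.conjExponent n : ℝ) = n / (n - 1) := by
    simpa [Real.conjExponent] using
      (Real.holderConjugate_iff_eq_conjExponent (by exact_mod_cast hn1)).1 hconj.coe
  have hp0 : (0 : ℝ) < NNReal.conjExponent n := by
    rw [hp]
    have : 0 < (n : ℝ) - 1 := by linarith
    positivity
  have hgns := eLpNorm_le_eLpNorm_fderiv_one (volume : Measure (𝔼 n)) hu huc hconj'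
  have hcheb := meas_ge_le_mul_pow_eLpNorm_enorm (μ := (volume : Measure (𝔼 n)))
    (p := (NNReal.conjExponent n : ℝ≥0∞)) (by
      have : NNReal.conjExponent n ≠ 0 := by
        intro h; rw [h] at hp0; simp at hp0
      simpa using this) ENNReal.coe_ne_top
    hu.continuous.aestronglyMeasurable (ε := 1) one_ne_zero (by simp)
  rw [inv_one, ENNReal.one_rpow, one_mul, ENNReal.coe_toReal] at hcheb
  have hsub : Ω ∩ {x | t + h ≤ |v x|} ⊆
      {x | 1 ≤ ‖Ω.indicator (fun y => Φ |v y|) x‖ₑ} := by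
    rintro x ⟨hxΩ, hx⟩
    rw [Set.mem_ofPred_eq, Set.indicator_of_mem hxΩ, hB.primitive_right _ hx,
      Real.enorm_eq_ofReal (by linarith [hB.one_le])]
    exact ENNReal.one_le_ofReal.2 hB.one_le
  have hV := (measure_mono hsub).trans hcheb
  have hV' : volume (Ω ∩ {x | t + h ≤ |v x|}) ^ (((n : ℝ) - 1) / n) ≤
      eLpNorm (Ω.indicator fun y => Φ |v y|) (NNReal.conjExponent n) volume := by
    have h1 : ((n : ℝ) - 1) / n = (NNReal.conjExponent n : ℝ)⁻¹ := by rw [hp, inv_div]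
    rw [h1, ENNReal.rpow_inv_le_iff hp0]
    exact hV
  refine hV'.trans (hgns.trans (mul_le_mul_right ?_ _))
  rw [eLpNorm_one_eq_lintegral_enorm]
  refine le_trans ?_ (lintegral_levelMeasure_le hΩ hv hB measurable_const)
  rw [levelMeasure, lintegral_one, withDensity_apply _ MeasurableSet.univ, Measure.restrict_univ]
  refine lintegral_mono fun y => ?_
  rw [(hud y).fderiv]
  by_cases hy : y ∈ Ω
  · rw [Set.indicator_of_mem hy, Set.indicator_of_mem hy, ← ofReal_norm, norm_smul,
      Real.norm_eq_abs]
    refine ENNReal.ofReal_le_ofReal ?_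
    have : ‖gradient v y‖ = ‖fderiv ℝ v y‖ := by rw [gradient, LinearIsometryEquiv.norm_map]
    rw [this]
    exact mul_le_mul_of_nonneg_right (hPd _) (norm_nonneg _)
  · rw [Set.indicator_of_notMem hy, ← ofReal_norm, norm_zero, ENNReal.ofReal_zero]
    exact zero_le

end LevelEstimates

section Differentiation

variable {n : ℕ}

theorem ae_tendsto_inv_mul_closedBall (ρ : Measure ℝ) [IsFiniteMeasure ρ] :
    ∀ᵐ t, Tendsto (fun h => ENNReal.ofReal h⁻¹ * ρ (Metric.closedBall t h)) (𝓝[>] 0)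
      (𝓝 (2 * ρ.rnDeriv volume t)) := by
  filter_upwards [Besicovitch.ae_tendsto_rnDeriv ρ volume] with t ht
  refine (ENNReal.Tendsto.const_mul ht (.inr (by simp))).congr' ?_
  filter_upwards [self_mem_nhdsWithin] with h hh
  have hh : 0 < h := hh
  rw [Real.volume_closedBall, ENNReal.ofReal_mul zero_le_two, ENNReal.ofReal_ofNat,
    ENNReal.ofReal_inv_of_pos hh, ENNReal.div_eq_inv_mul, ENNReal.mul_inv (by simp) (by simp),
    ← mul_assoc, ← mul_assoc, ENNReal.mul_inv_cancel (by simp) (by simp), one_mul]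

theorem ae_tendsto_inv_mul_closedBall_half (ρ : Measure ℝ) [IsFiniteMeasure ρ] :
    ∀ᵐ t, Tendsto (fun h => ENNReal.ofReal h⁻¹ * ρ (Metric.closedBall t (h / 2))) (𝓝[>] 0)
      (𝓝 (ρ.rnDeriv volume t)) := by
  filter_upwards [Besicovitch.ae_tendsto_rnDeriv ρ volume] with t ht
  have hhalf : Tendsto (fun h : ℝ => h / 2) (𝓝[>] 0) (𝓝[>] 0) := by
    refine tendsto_nhdsWithin_iff.2 ⟨?_, ?_⟩
    · refine Tendsto.mono_left ?_ nhdsWithin_le_nhds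
      simpa using (continuous_id.div_const (2 : ℝ)).tendsto 0
    · filter_upwards [self_mem_nhdsWithin] with h hh
      exact half_pos (Set.mem_Ioi.1 hh)
  refine (ht.comp hhalf).congr' ?_
  filter_upwards [self_mem_nhdsWithin] with h hh
  have hh : 0 < h := hh
  rw [Function.comp_apply, Real.volume_closedBall, mul_div_cancel₀ _ two_ne_zero,
    ENNReal.ofReal_inv_of_pos hh, ENNReal.div_eq_inv_mul]

theorem levelMass_univ {Ω : Set (𝔼 n)} {v : (𝔼 n) → ℝ} (hv : Continuous v)
    (f : (𝔼 n) → ℝ≥0∞) :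
    levelMass Ω v f Set.univ = ∫⁻ y in Ω, f y * ENNReal.ofReal ‖gradient v y‖ := by
  rw [levelMass_apply hv f MeasurableSet.univ]
  congr 2
  ext; simp

theorem levelMass_add {Ω : Set (𝔼 n)} {v : (𝔼 n) → ℝ} (hv : ContDiff ℝ 1 v)
    {f g : (𝔼 n) → ℝ≥0∞} (hf : Measurable f) :
    levelMass Ω v (fun y => f y + g y) = levelMass Ω v f + levelMass Ω v g := by
  ext S hS
  rw [Measure.add_apply, levelMass_apply hv.continuous _ hS, levelMass_apply hv.continuous _ hS,
    levelMass_apply hv.continuous _ hS, ← lintegral_add_left]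
  · simp only [add_mul]
  · exact hf.mul (continuous_gradient hv).measurable.norm.ennreal_ofReal

theorem isFiniteMeasure_levelMass_of_le_one {Ω : Set (𝔼 n)} (hb : IsBounded Ω)
    {v : (𝔼 n) → ℝ} (hv : ContDiff ℝ 1 v) {f : (𝔼 n) → ℝ≥0∞} (hf : ∀ y, f y ≤ 1) :
    IsFiniteMeasure (levelMass Ω v f) := by
  obtain ⟨L, hL⟩ := hb.isCompact_closure.exists_bound_of_continuousOn
    (continuous_gradient hv).continuousOn
  have hfin : ENNReal.ofReal L * volume Ω < ⊤ :=
    ENNReal.mul_lt_top ENNReal.ofReal_lt_top hb.measure_lt_top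
  refine ⟨lt_of_le_of_lt ?_ hfin⟩
  rw [levelMass_univ hv.continuous, ← setLIntegral_const]
  refine setLIntegral_mono measurable_const fun y hy => ?_
  exact (mul_le_of_le_one_left zero_le (hf y)).trans
    (ENNReal.ofReal_le_ofReal (hL y (subset_closure hy)))

theorem levelMass_small_gradient_le {Ω : Set (𝔼 n)} {v : (𝔼 n) → ℝ} (hv : ContDiff ℝ 1 v)
    (δ : ℝ) : levelMass Ω v ({y | δ ≤ ‖gradient v y‖}ᶜ.indicator fun _ => 1) Set.univ ≤
      ENNReal.ofReal δ * volume Ω := by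
  rw [levelMass_univ hv.continuous, ← setLIntegral_const]
  refine setLIntegral_mono measurable_const fun y _ => ?_
  by_cases hy : δ ≤ ‖gradient v y‖
  · simp [hy]
  · simpa [hy] using ENNReal.ofReal_le_ofReal (not_le.1 hy).le

/-- Michael-Simon inequality for almost every level set. -/
theorem ae_rnDeriv_levelMass_le (hn : 2 < n) {r : ℝ} (hr : 1 ≤ r) {Ω : Set (𝔼 n)}
    (hΩ : IsOpen Ω) (hb : IsBounded Ω) {v : (𝔼 n) → ℝ} (hv : ContDiff ℝ 2 v)
    (hv0 : ∀ x ∈ frontier Ω, v x = 0)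
    [IsFiniteMeasure (levelMass Ω v fun y => ENNReal.ofReal |meanCurv v y| ^ r)] :
    ∀ᵐ t, 0 < t → (levelMass Ω v fun _ => 1).rnDeriv volume t ≤
      michaelSimonConst n *
        (2 * (levelMass Ω v fun _ => 1).rnDeriv volume t) ^ (1 / ((n : ℝ) - 1) + (1 - 1 / r)) *
        (2 * (levelMass Ω v fun y => ENNReal.ofReal |meanCurv v y| ^ r).rnDeriv volume t) ^
          (1 / r) := by
  have hv1 : ContDiff ℝ 1 v := hv.of_le one_le_two
  have hn1 : (2 : ℝ) < n := by exact_mod_cast hn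
  have hr1 : 1 / r ≤ 1 := by rw [div_le_one (by linarith)]; exact hr
  have hr0 : 0 < 1 / r := by positivity
  have hk0 : 0 < 1 / ((n : ℝ) - 1) := by
    have : 0 < (n : ℝ) - 1 := by linarith
    positivity
  have hθ : 0 < 1 / ((n : ℝ) - 1) + (1 - 1 / r) := by linarith
  set β := levelMass Ω v fun y => ENNReal.ofReal |meanCurv v y| ^ r
  set α := levelMass Ω v fun _ => 1 with hα
  have hαfin : IsFiniteMeasure α := isFiniteMeasure_levelMass_of_le_one hb hv1 fun _ => le_rfl
  set F : ℝ → ℝ≥0∞ := fun t => michaelSimonConst n *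
    (2 * α.rnDeriv volume t) ^ (1 / ((n : ℝ) - 1) + (1 - 1 / r)) *
      (2 * β.rnDeriv volume t) ^ (1 / r) with hF
  have hFm : Measurable F := by
    refine (measurable_const.mul (Measurable.pow_const ?_ _)).mul (Measurable.pow_const ?_ _)
    · exact measurable_const.mul (Measure.measurable_rnDeriv _ _)
    · exact measurable_const.mul (Measure.measurable_rnDeriv _ _)
  have key : ∀ δ : ℝ, 0 < δ →
      ∫⁻ t in Set.Ioi 0, (α.rnDeriv volume t - F t) ≤ ENNReal.ofReal δ * volume Ω := by
    intro δ hδ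
    set α₁ := levelMass Ω v ({y | δ ≤ ‖gradient v y‖}.indicator fun _ => 1) with hα₁
    set α₂ := levelMass Ω v ({y | δ ≤ ‖gradient v y‖}ᶜ.indicator fun _ => 1) with hα₂
    have h1 : IsFiniteMeasure α₁ := isFiniteMeasure_levelMass_of_le_one hb hv1 fun y =>
      Set.indicator_le_self' (fun _ _ => zero_le_one) y
    have h2 : IsFiniteMeasure α₂ := isFiniteMeasure_levelMass_of_le_one hb hv1 fun y =>
      Set.indicator_le_self' (fun _ _ => zero_le_one) y
    have hsum : α = α₁ + α₂ := by
      rw [hα₁, hα₂, ← levelMass_add hv1, hα]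
      · congr 1
        ext y
        by_cases hy : δ ≤ ‖gradient v y‖ <;> simp [hy]
      · exact measurable_const.indicator
          (measurableSet_le measurable_const (continuous_gradient hv1).measurable.norm)
    have hle : ∀ᵐ t, 0 < t → α₁.rnDeriv volume t ≤ F t := by
      filter_upwards [ae_tendsto_inv_mul_closedBall_half α₁, ae_tendsto_inv_mul_closedBall α,
        ae_tendsto_inv_mul_closedBall β, α.rnDeriv_lt_top volume,
        β.rnDeriv_lt_top volume] with t ht1 ht2 ht3 hαt hβt ht
      obtain ⟨h₀, hh₀, hms⟩ := exists_levelMass_le hn hr hΩ hb hv hv0 ht hδ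
      have hm := michaelSimonConst_ne_top n
      refine le_of_tendsto_of_tendsto ht1 (ENNReal.Tendsto.mul
        (ENNReal.Tendsto.const_mul (ht2.ennrpow_const _) (.inr hm)) (.inr ?_)
        (ht3.ennrpow_const _) (.inr ?_)) ?_
      · exact ENNReal.rpow_ne_top_of_nonneg hr0.le (ENNReal.mul_ne_top (by simp) hβt.ne)
      · exact ENNReal.mul_ne_top hm
          (ENNReal.rpow_ne_top_of_nonneg hθ.le (ENNReal.mul_ne_top (by simp) hαt.ne))
      · filter_upwards [Ioo_mem_nhdsGT hh₀] with h hh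
        exact hms h hh.1 hh.2
    calc ∫⁻ t in Set.Ioi 0, (α.rnDeriv volume t - F t)
        ≤ ∫⁻ t in Set.Ioi 0, α₂.rnDeriv volume t := by
          refine lintegral_mono_ae ?_
          refine (ae_restrict_iff' measurableSet_Ioi).2 ?_
          filter_upwards [hle, Measure.rnDeriv_add α₁ α₂ volume] with t h3 h4 ht
          rw [hsum, h4, Pi.add_apply, tsub_le_iff_left]
          exact add_le_add_left (h3 ht) _
      _ ≤ ∫⁻ t, α₂.rnDeriv volume t := setLIntegral_le_lintegral _ _
      _ ≤ α₂ Set.univ := Measure.lintegral_rnDeriv_le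
      _ ≤ _ := levelMass_small_gradient_le hv1 δ
  have hzero : ∫⁻ t in Set.Ioi 0, (α.rnDeriv volume t - F t) = 0 := by
    refine le_antisymm (ge_of_tendsto (f := fun δ : ℝ => ENNReal.ofReal δ * volume Ω)
      (x := 𝓝[>] 0) ?_ ?_) zero_le
    · have : Tendsto (fun δ : ℝ => ENNReal.ofReal δ) (𝓝[>] 0) (𝓝 0) := by
        have := (ENNReal.continuous_ofReal.tendsto (0 : ℝ)).mono_left
          (nhdsWithin_le_nhds (s := Set.Ioi 0))
        simpa using this
      simpa using ENNReal.Tendsto.mul_const this (.inr hb.measure_lt_top.ne)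
    · filter_upwards [self_mem_nhdsWithin] with δ hδ
      exact key δ hδ
  have hsub : Measurable fun t => α.rnDeriv volume t - F t :=
    (Measure.measurable_rnDeriv _ _).sub hFm
  filter_upwards [(ae_restrict_iff' measurableSet_Ioi).1
    ((lintegral_eq_zero_iff hsub).1 hzero)] with t h0 ht
  exact tsub_eq_zero_iff_le.1 (h0 ht)

theorem ae_volume_rpow_le_rnDeriv_levelMass (hn : 2 ≤ n) {Ω : Set (𝔼 n)} (hΩ : IsOpen Ω)
    (hb : IsBounded Ω) {v : (𝔼 n) → ℝ} (hv : ContDiff ℝ 1 v)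
    (hv0 : ∀ x ∈ frontier Ω, v x = 0) :
    ∀ᵐ t, 0 < t → volume (Ω ∩ {x | t < |v x|}) ^ (((n : ℝ) - 1) / n) ≤
      eLpNormLESNormFDerivOneConst (volume : Measure (𝔼 n)) (NNReal.conjExponent n) *
        (2 * (levelMass Ω v fun _ => 1).rnDeriv volume t) := by
  have hαfin : IsFiniteMeasure (levelMass Ω v fun _ => 1) :=
    isFiniteMeasure_levelMass_of_le_one hb hv fun _ => le_rfl
  have hn1 : (1 : ℝ) < n := by exact_mod_cast hn
  have he : 0 < ((n : ℝ) - 1) / n := by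
    have : 0 < (n : ℝ) - 1 := by linarith
    positivity
  filter_upwards [ae_tendsto_inv_mul_closedBall (levelMass Ω v fun _ => 1)] with t htend ht
  have hlim : ∀ ε : ℝ, 0 < ε → volume (Ω ∩ {x | t + ε ≤ |v x|}) ^ (((n : ℝ) - 1) / n) ≤
      eLpNormLESNormFDerivOneConst (volume : Measure (𝔼 n)) (NNReal.conjExponent n) *
        (2 * (levelMass Ω v fun _ => 1).rnDeriv volume t) := by
    intro ε hε
    refine ge_of_tendsto (ENNReal.Tendsto.const_mul htend (.inr ENNReal.coe_ne_top)) ?_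
    filter_upwards [Ioo_mem_nhdsGT (lt_min hε ht)] with h hh
    refine le_trans (ENNReal.rpow_le_rpow (measure_mono ?_) he.le) (volume_rpow_le_levelMass hn hΩ
      hb hv hv0 hh.1 (hh.2.trans_le (min_le_right _ _)))
    rintro x ⟨hx, hx2⟩
    refine ⟨hx, le_trans (b := t + ε) ?_ hx2⟩
    linarith [hh.2.trans_le (min_le_left _ _)]
  rw [← ENNReal.le_rpow_inv_iff he]
  have hU : Ω ∩ {x | t < |v x|} = ⋃ m : ℕ, Ω ∩ {x | t + 1 / ((m : ℝ) + 1) ≤ |v x|} := by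
    ext x
    simp only [Set.mem_inter_iff, Set.mem_iUnion, Set.mem_ofPred_eq]
    refine ⟨fun hx => ?_, ?_⟩
    · obtain ⟨m, hm⟩ := exists_nat_one_div_lt (sub_pos.2 hx.2)
      exact ⟨m, hx.1, by linarith⟩
    · rintro ⟨m, hx, hm⟩
      have := Nat.one_div_pos_of_nat (α := ℝ) (n := m)
      exact ⟨hx, by linarith⟩
  rw [hU, Monotone.measure_iUnion]
  · refine iSup_le fun m => ?_
    rw [ENNReal.le_rpow_inv_iff he]
    exact hlim _ Nat.one_div_pos_of_nat
  · intro i j hij x hx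
    refine ⟨hx.1, le_trans (b := t + 1 / ((i : ℝ) + 1)) ?_ hx.2⟩
    have := Nat.one_div_le_one_div (α := ℝ) hij
    linarith

theorem ENNReal.rpow_le_of_le_mul_rpow {V a b M D : ℝ≥0∞} {k r N : ℝ} (hr : 1 ≤ r) (hrk : r < k)
    (hN : 0 < N) (ha : a ≠ ⊤) (h1 : V ^ (k / N) ≤ D * a)
    (h2 : a ≤ M * a ^ (1 / k + (1 - 1 / r)) * b ^ (1 / r)) :
    V ^ ((k - r) / N) ≤ D ^ ((k - r) / k) * M ^ r * b := by
  have hr0 : 0 < r := by linarith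
  have hk0 : 0 < k := by linarith
  have hkr : 0 < (k - r) / k := div_pos (by linarith) hk0
  have hV : V ^ ((k - r) / N) ≤ D ^ ((k - r) / k) * a ^ ((k - r) / k) := by
    rw [← ENNReal.mul_rpow_of_nonneg _ _ hkr.le,
      show (k - r) / N = k / N * ((k - r) / k) by field_simp, ENNReal.rpow_mul]
    exact ENNReal.rpow_le_rpow h1 hkr.le
  refine hV.trans ?_
  rw [mul_assoc]
  refine mul_le_mul_right ?_ _
  rcases eq_or_ne a 0 with rfl | ha0
  · rw [ENNReal.zero_rpow_of_pos hkr]; exact zero_le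
  have hθ : a ^ (1 / k + (1 - 1 / r)) * a ^ ((k - r) / (k * r)) = a := by
    rw [← ENNReal.rpow_add _ _ ha0 ha]
    convert ENNReal.rpow_one a using 2
    field_simp
    ring
  have h3 : a ^ ((k - r) / (k * r)) ≤ M * b ^ (1 / r) := by
    have hc0 : a ^ (1 / k + (1 - 1 / r)) ≠ 0 := by
      simp [ENNReal.rpow_eq_zero_iff, ha0, ha]
    have hct : a ^ (1 / k + (1 - 1 / r)) ≠ ⊤ := by
      simp [ENNReal.rpow_eq_top_iff, ha0, ha]
    rw [← ENNReal.mul_le_mul_iff_right hc0 hct, hθ]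
    exact h2.trans_eq (by ring)
  calc a ^ ((k - r) / k) = (a ^ ((k - r) / (k * r))) ^ r := by
        rw [← ENNReal.rpow_mul]; congr 1; field_simp
    _ ≤ (M * b ^ (1 / r)) ^ r := ENNReal.rpow_le_rpow h3 hr0.le
    _ = M ^ r * b := by
        rw [ENNReal.mul_rpow_of_nonneg _ _ hr0.le, ← ENNReal.rpow_mul, one_div,
          inv_mul_cancel₀ hr0.ne', ENNReal.rpow_one]

/-- The constant in the differential inequality for the distribution function. -/
noncomputable def decayConst (n : ℕ) (r : ℝ) : ℝ≥0∞ :=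
  (eLpNormLESNormFDerivOneConst (volume : Measure (𝔼 n)) (NNReal.conjExponent n) : ℝ≥0∞) ^
    (((n : ℝ) - 1 - r) / ((n : ℝ) - 1)) * (2 * michaelSimonConst n) ^ r * 2

theorem decayConst_ne_top (n : ℕ) {r : ℝ} (hr : 1 ≤ r) (hrk : r < (n : ℝ) - 1) :
    decayConst n r ≠ ⊤ := by
  refine ENNReal.mul_ne_top (ENNReal.mul_ne_top ?_ ?_) (by simp)
  · refine ENNReal.rpow_ne_top_of_nonneg (div_nonneg ?_ ?_) ENNReal.coe_ne_top <;> linarith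
  · exact ENNReal.rpow_ne_top_of_nonneg (by linarith)
      (ENNReal.mul_ne_top (by simp) (michaelSimonConst_ne_top n))

theorem ae_volume_rpow_le_rnDeriv (hn : 2 < n) {r : ℝ} (hr : 1 ≤ r) (hrk : r < (n : ℝ) - 1)
    {Ω : Set (𝔼 n)} (hΩ : IsOpen Ω) (hb : IsBounded Ω) {v : (𝔼 n) → ℝ} (hv : ContDiff ℝ 2 v)
    (hv0 : ∀ x ∈ frontier Ω, v x = 0)
    [IsFiniteMeasure (levelMass Ω v fun y => ENNReal.ofReal |meanCurv v y| ^ r)] :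
    ∀ᵐ t, 0 < t → volume (Ω ∩ {x | t < |v x|}) ^ (((n : ℝ) - 1 - r) / n) ≤
      decayConst n r *
        (levelMass Ω v fun y => ENNReal.ofReal |meanCurv v y| ^ r).rnDeriv volume t := by
  have hv1 : ContDiff ℝ 1 v := hv.of_le one_le_two
  have hαfin : IsFiniteMeasure (levelMass Ω v fun _ => 1) :=
    isFiniteMeasure_levelMass_of_le_one hb hv1 fun _ => le_rfl
  filter_upwards [ae_rnDeriv_levelMass_le hn hr hΩ hb hv hv0,
    ae_volume_rpow_le_rnDeriv_levelMass hn.le hΩ hb hv1 hv0,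
    (levelMass Ω v fun _ => 1).rnDeriv_lt_top volume] with t h1 h2 h3 ht
  rw [decayConst, mul_assoc _ 2]
  refine ENNReal.rpow_le_of_le_mul_rpow hr hrk (by positivity) (ENNReal.mul_ne_top (by simp) h3.ne)
    (h2 ht) ?_
  refine (mul_le_mul_right (h1 ht) 2).trans_eq ?_
  ring

end Differentiation

section LayerCake

theorem antitone_measure_Ici (ρ : Measure ℝ) : Antitone fun t => ρ (Set.Ici t) :=
  fun _ _ h => measure_mono (Set.Ici_subset_Ici.2 h)

theorem measure_setOf_measure_Ici_lt_le (ρ : Measure ℝ) [IsFiniteMeasure ρ] (y : ℝ≥0∞) :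
    ρ {t | ρ (Set.Ici t) < y} ≤ y := by
  have hJ : MeasurableSet {t | ρ (Set.Ici t) < y} :=
    measurableSet_lt (antitone_measure_Ici ρ).measurable measurable_const
  by_contra! h
  obtain ⟨K, hKJ, hK, hlt⟩ := hJ.exists_lt_isCompact_of_ne_top (measure_ne_top ρ _) h
  rcases K.eq_empty_or_nonempty with rfl | hne
  · simp at hlt
  · obtain ⟨m, hm⟩ := hK.exists_isLeast hne
    have h1 : ρ K ≤ ρ (Set.Ici m) := measure_mono fun x hx => hm.2 hx
    exact absurd (hlt.trans_le h1) (not_lt.2 (hKJ hm.1).le)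

theorem measureReal_superlevel_inv_le (ρ : Measure ℝ) [IsFiniteMeasure ρ] {s τ : ℝ}
    (hs : 0 < ρ.real (Set.Ioi s)) (hτ : 0 < τ) :
    ρ.restrict (Set.Iic s) {t | τ < (ρ.real (Set.Ici t))⁻¹} ≤
      ENNReal.ofReal (min (ρ.real Set.univ) τ⁻¹ - ρ.real (Set.Ioi s)) := by
  have hmeas : Measurable fun t => (ρ.real (Set.Ici t))⁻¹ :=
    (antitone_measure_Ici ρ).measurable.ennreal_toReal.inv
  rw [Measure.restrict_apply (measurableSet_lt measurable_const hmeas)]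
  set E := {t | τ < (ρ.real (Set.Ici t))⁻¹} ∩ Set.Iic s with hE
  rcases E.eq_empty_or_nonempty with h | ⟨e, he, hes⟩
  · simp [h]
  have hpos : ∀ t ≤ s, 0 < ρ.real (Set.Ici t) := fun t ht =>
    hs.trans_le (measureReal_mono fun x hx => ht.trans (Set.mem_Ioi.1 hx).le)
  have hlt : ∀ t ≤ s, τ < (ρ.real (Set.Ici t))⁻¹ → ρ.real (Set.Ici t) < τ⁻¹ := fun t ht h =>
    (lt_inv_comm₀ hτ (hpos t ht)).1 h
  have hsub : E ∪ Set.Ioi s ⊆ {t | ρ (Set.Ici t) < ENNReal.ofReal τ⁻¹} := by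
    have hiff : ∀ t, ρ.real (Set.Ici t) < τ⁻¹ → ρ (Set.Ici t) < ENNReal.ofReal τ⁻¹ := fun t h => by
      rw [← ofReal_measureReal]
      exact (ENNReal.ofReal_lt_ofReal_iff (inv_pos.2 hτ)).2 h
    rintro t (⟨h1, h2⟩ | h1)
    · exact hiff t (hlt t h2 h1)
    · exact hiff t (lt_of_le_of_lt (measureReal_mono (Set.Ici_subset_Ici.2
        (le_trans hes (Set.mem_Ioi.1 h1).le))) (hlt e hes he))
  have hdisj : Disjoint E (Set.Ioi s) :=
    Set.disjoint_left.2 fun x hx hx2 => absurd (Set.mem_Ioi.1 hx2) (not_lt.2 hx.2)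
  have hle : ρ.real E + ρ.real (Set.Ioi s) ≤ τ⁻¹ := by
    rw [← measureReal_union hdisj measurableSet_Ioi]
    have := (measure_mono hsub).trans (measure_setOf_measure_Ici_lt_le ρ _)
    exact ENNReal.toReal_le_of_le_ofReal (inv_pos.2 hτ).le this
  have hle2 : ρ.real E + ρ.real (Set.Ioi s) ≤ ρ.real Set.univ := by
    rw [← measureReal_union hdisj measurableSet_Ioi]
    exact measureReal_mono (Set.subset_univ _)
  rw [← ofReal_measureReal]
  refine ENNReal.ofReal_le_ofReal ?_
  rw [le_sub_iff_add_le]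
  exact le_min hle2 hle

theorem lintegral_min_inv_sub_le {T V : ℝ} (hV : 0 < V) (hVT : V ≤ T) :
    ∫⁻ τ in Set.Ioi 0, ENNReal.ofReal (min T τ⁻¹ - V) ≤ ENNReal.ofReal (Real.log (T / V)) := by
  have hT : 0 < T := hV.trans_le hVT
  have hinv : T⁻¹ ≤ V⁻¹ := inv_anti₀ hV hVT
  have hset : Set.Ioi (0 : ℝ) = Set.Ioc 0 T⁻¹ ∪ (Set.Ioc T⁻¹ V⁻¹ ∪ Set.Ioi V⁻¹) := by
    rw [Set.Ioc_union_Ioi_eq_Ioi hinv, Set.Ioc_union_Ioi_eq_Ioi (inv_pos.2 hT).le]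
  have h1 : ∫⁻ τ in Set.Ioc 0 T⁻¹, ENNReal.ofReal (min T τ⁻¹ - V) ≤
      ENNReal.ofReal ((T - V) * T⁻¹) := by
    refine (setLIntegral_mono (g := fun _ => ENNReal.ofReal (T - V)) measurable_const
      fun τ _ => ENNReal.ofReal_le_ofReal (sub_le_sub_right (min_le_left _ _) _)).trans_eq ?_
    rw [setLIntegral_const, Real.volume_Ioc, sub_zero, ENNReal.ofReal_mul (sub_nonneg.2 hVT)]
  have h3 : ∫⁻ τ in Set.Ioi V⁻¹, ENNReal.ofReal (min T τ⁻¹ - V) = 0 := by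
    rw [setLIntegral_congr_fun (g := fun _ => 0) measurableSet_Ioi, lintegral_zero]
    intro τ hτ
    have h4 : τ⁻¹ ≤ V := inv_le_of_inv_le₀ hV (Set.mem_Ioi.1 hτ).le
    exact ENNReal.ofReal_of_nonpos (by linarith [min_le_right T τ⁻¹])
  have hcont : ContinuousOn (fun τ : ℝ => τ⁻¹ - V) (Set.uIcc T⁻¹ V⁻¹) := by
    rw [Set.uIcc_of_le hinv]
    exact (continuousOn_inv₀.mono fun τ hτ => ((inv_pos.2 hT).trans_le hτ.1).ne').sub
      continuousOn_const
  have h2 : ∫⁻ τ in Set.Ioc T⁻¹ V⁻¹, ENNReal.ofReal (min T τ⁻¹ - V) ≤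
      ENNReal.ofReal (Real.log (T / V) - (T - V) * T⁻¹) := by
    refine (lintegral_mono fun τ => ENNReal.ofReal_le_ofReal
      (sub_le_sub_right (min_le_right _ _) _)).trans ?_
    rw [← ofReal_integral_eq_lintegral_ofReal
      ((intervalIntegrable_iff_integrableOn_Ioc_of_le hinv).1 hcont.intervalIntegrable),
      ← intervalIntegral.integral_of_le hinv, intervalIntegral.integral_sub, integral_inv_of_pos
        (inv_pos.2 hT) (inv_pos.2 hV), intervalIntegral.integral_const]
    · refine ENNReal.ofReal_le_ofReal (le_of_eq ?_)
      rw [inv_div_inv, smul_eq_mul]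
      field_simp
    · exact ((hcont.add (continuousOn_const (c := V))).congr fun τ _ =>
        (sub_add_cancel _ _).symm).intervalIntegrable
    · exact intervalIntegrable_const
    · rw [EventuallyLE, ae_restrict_iff' measurableSet_Ioc]
      refine .of_forall fun τ hτ => sub_nonneg.2 ?_
      exact le_inv_of_le_inv₀ ((inv_pos.2 hT).trans hτ.1) hτ.2
  have hlog : 0 ≤ Real.log (T / V) - (T - V) * T⁻¹ := by
    have := Real.add_one_le_exp (Real.log (V / T))
    rw [Real.exp_log (by positivity), Real.log_div hV.ne' hT.ne'] at this
    rw [Real.log_div hT.ne' hV.ne', sub_mul, mul_inv_cancel₀ hT.ne', ← div_eq_mul_inv]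
    linarith
  have hdisj : Disjoint (Set.Ioc T⁻¹ V⁻¹) (Set.Ioi V⁻¹) :=
    Set.disjoint_left.2 fun x hx hx2 => absurd (Set.mem_Ioi.1 hx2) (not_lt.2 hx.2)
  rw [hset]
  refine (lintegral_union_le _ _ _).trans ((add_le_add h1 (lintegral_union_le _ _ _)).trans ?_)
  rw [h3, add_zero]
  refine (add_le_add_right h2 _).trans_eq ?_
  rw [← ENNReal.ofReal_add (mul_nonneg (sub_nonneg.2 hVT) (inv_pos.2 hT).le) hlog]
  congr 1
  ring

theorem lintegral_inv_measure_Ici_le (ρ : Measure ℝ) [IsFiniteMeasure ρ] {s : ℝ}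
    (hs : 0 < ρ.real (Set.Ioi s)) :
    ∫⁻ t in Set.Iic s, (ρ (Set.Ici t))⁻¹ ∂ρ ≤
      ENNReal.ofReal (Real.log (ρ.real Set.univ / ρ.real (Set.Ioi s))) := by
  have hpos : ∀ t ≤ s, 0 < ρ.real (Set.Ici t) := fun t ht =>
    hs.trans_le (measureReal_mono fun x hx => ht.trans (Set.mem_Ioi.1 hx).le)
  have hmeas : Measurable fun t => (ρ.real (Set.Ici t))⁻¹ :=
    (antitone_measure_Ici ρ).measurable.ennreal_toReal.inv
  rw [setLIntegral_congr_fun (g := fun t => ENNReal.ofReal (ρ.real (Set.Ici t))⁻¹)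
    measurableSet_Iic fun t ht => by
      simp only [ENNReal.ofReal_inv_of_pos (hpos t ht), ofReal_measureReal (measure_ne_top ρ _)],
    lintegral_eq_lintegral_meas_lt _ (.of_forall fun t => by positivity) hmeas.aemeasurable]
  exact (lintegral_mono_ae ((ae_restrict_iff' measurableSet_Ioi).2 (.of_forall fun τ hτ =>
    measureReal_superlevel_inv_le ρ hs hτ))).trans
    (lintegral_min_inv_sub_le hs (measureReal_mono (Set.subset_univ _)))

end LayerCake

section Decay

variable {n : ℕ}

theorem lintegral_levelMass {Ω : Set (𝔼 n)} {v : (𝔼 n) → ℝ} (hv : ContDiff ℝ 1 v)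
    {f : (𝔼 n) → ℝ≥0∞} (hf : Measurable f) {φ : ℝ → ℝ≥0∞} (hφ : Measurable φ) {S : Set ℝ}
    (hS : MeasurableSet S) :
    ∫⁻ t in S, φ t ∂(levelMass Ω v f) =
      ∫⁻ y in {y | |v y| ∈ S} ∩ Ω, (f y * ENNReal.ofReal ‖gradient v y‖) * φ |v y| := by
  have hm : MeasurableSet {y | |v y| ∈ S} := hv.continuous.abs.measurable hS
  have hd : Measurable fun y => f y * ENNReal.ofReal ‖gradient v y‖ :=
    hf.mul (continuous_gradient hv).measurable.norm.ennreal_ofReal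
  have hφi : Measurable ({y | |v y| ∈ S}.indicator fun y => φ |v y|) :=
    (hφ.comp hv.continuous.abs.measurable).indicator hm
  rw [levelMass, setLIntegral_map hS hφ hv.continuous.abs.measurable,
    show (fun y => |v y|) ⁻¹' S = {y | |v y| ∈ S} from rfl, ← lintegral_indicator hm, lintegral_withDensity_eq_lintegral_mul _ hd hφi, ← Measure.restrict_restrict hm,
    ← lintegral_indicator hm]
  refine lintegral_congr fun y => ?_
  by_cases hy : y ∈ {y | |v y| ∈ S} <;> simp [hy]

theorem isFiniteMeasure_levelMass_of_rpow {Ω : Set (𝔼 n)} (hb : IsBounded Ω)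
    {v : (𝔼 n) → ℝ} (hv : Continuous v) {f : (𝔼 n) → ℝ≥0∞} {p : ℝ} (hp : 1 < p)
    (hfin : ∫⁻ y in Ω, (f y * ENNReal.ofReal ‖gradient v y‖) ^ p ≠ ⊤) :
    IsFiniteMeasure (levelMass Ω v f) := by
  refine ⟨?_⟩
  rw [levelMass_univ hv]
  have hle : ∀ x : ℝ≥0∞, x ≤ 1 + x ^ p := fun x => by
    rcases le_total x 1 with h | h
    · exact le_add_right h
    · refine le_add_left ?_
      calc x = x ^ (1 : ℝ) := (ENNReal.rpow_one x).symm
        _ ≤ x ^ p := ENNReal.rpow_le_rpow_of_exponent_le h hp.le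
  refine (lintegral_mono fun y => hle _).trans_lt ?_
  rw [lintegral_add_left measurable_const, setLIntegral_const, one_mul]
  exact ENNReal.add_lt_top.2 ⟨hb.measure_lt_top, hfin.lt_top⟩

theorem ofReal_le_decay (hn : 2 < n) {p r : ℝ} (hp : 1 < p) (hr : 1 ≤ r)
    (hnpr : (n : ℝ) = p * (1 + r)) {Ω : Set (𝔼 n)} (hΩ : IsOpen Ω) (hb : IsBounded Ω)
    {v : (𝔼 n) → ℝ} (hv : ContDiff ℝ 2 v) (hv0 : ∀ x ∈ frontier Ω, v x = 0)
    (hfin : ∫⁻ y in Ω, (ENNReal.ofReal |meanCurv v y| ^ r *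
      ENNReal.ofReal ‖gradient v y‖) ^ p ≠ ⊤) {s : ℝ}
    (hVs : 0 < volume.real (Ω ∩ {x | s < |v x|})) :
    ENNReal.ofReal s ≤ decayConst n r *
      ((∫⁻ y in Ω, (ENNReal.ofReal |meanCurv v y| ^ r *
        ENNReal.ofReal ‖gradient v y‖) ^ p) ^ (1 / p) *
      ENNReal.ofReal (Real.log (volume.real Ω / volume.real (Ω ∩ {x | s < |v x|}))) ^
        (1 / (p / (p - 1)))) := by
  have hv1 : ContDiff ℝ 1 v := hv.of_le one_le_two
  have hp0 : 0 < p := by linarith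
  have hp1 : 0 < p - 1 := by linarith
  have hrk : r < (n : ℝ) - 1 := by rw [hnpr]; nlinarith
  have hβ := isFiniteMeasure_levelMass_of_rpow hb hv1.continuous hp hfin
  set β := levelMass Ω v fun y => ENNReal.ofReal |meanCurv v y| ^ r
  set ρ := (volume.restrict Ω).map fun y => |v y| with hρ
  have hΩfin : IsFiniteMeasure (volume.restrict Ω) := ⟨by simpa using hb.measure_lt_top⟩
  have hρfin : IsFiniteMeasure ρ := Measure.isFiniteMeasure_map _ _
  have hva : Measurable fun y => |v y| := hv.continuous.abs.measurable
  have hρapp : ∀ S, MeasurableSet S → ρ S = volume (Ω ∩ {x | |v x| ∈ S}) := fun S hS => by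
    rw [hρ, Measure.map_apply hva hS, Measure.restrict_apply (hva hS), Set.inter_comm]
    rfl
  have hρs : ρ (Set.Ioi s) = volume (Ω ∩ {x | s < |v x|}) := hρapp _ measurableSet_Ioi
  have hρuniv : ρ Set.univ = volume Ω := by simp [hρapp _ MeasurableSet.univ]
  set θ := ((n : ℝ) - 1 - r) / n with hθ
  have hn0 : (0 : ℝ) < n := by positivity
  have hθp : θ * (p / (p - 1)) = 1 := by
    rw [hθ, hnpr]
    have : 0 < 1 + r := by linarith
    field_simp
    ring
  have hθ0 : 0 < θ := div_pos (by linarith) hn0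
  set φ : ℝ → ℝ≥0∞ := fun t => (ρ (Set.Ici t) ^ θ)⁻¹ with hφ
  have hφm : Measurable φ := ((antitone_measure_Ici ρ).measurable.pow_const _).inv
  have hIci : ∀ t ≤ s, ρ (Set.Ici t) ≠ 0 := fun t ht h0 => by
    have h1 : ρ (Set.Ioi s) = 0 :=
      measure_mono_null (fun x hx => ht.trans (Set.mem_Ioi.1 hx).le) h0
    rw [measureReal_def, ← hρs, h1] at hVs
    simp at hVs
  have hatom : ∀ᵐ t, ρ (Set.Ici t) = ρ (Set.Ioi t) := by
    have hc := (Measure.countable_meas_level_set_pos (μ := ρ) measurable_id).ae_notMem volume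
    filter_upwards [hc] with t ht
    have h0 : ρ {t} = 0 := by simpa using ht
    exact measure_congr (Ioi_ae_eq_Ici' h0).symm
  have hdiff := ae_volume_rpow_le_rnDeriv hn hr hrk hΩ hb hv hv0
  have step1 : ENNReal.ofReal s ≤ decayConst n r * ∫⁻ t in Set.Ioc 0 s, φ t ∂β := by
    calc ENNReal.ofReal s = ∫⁻ t in Set.Ioc 0 s, 1 := by simp
      _ ≤ ∫⁻ t in Set.Ioc 0 s, decayConst n r * (β.rnDeriv volume t * φ t) := by
        refine lintegral_mono_ae ((ae_restrict_iff' measurableSet_Ioc).2 ?_)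
        filter_upwards [hdiff, hatom] with t h1 h2 ht
        have h3 := h1 ht.1
        rw [show volume (Ω ∩ {x | t < |v x|}) = ρ (Set.Ioi t) from
          (hρapp _ measurableSet_Ioi).symm, ← h2] at h3
        rw [← mul_assoc, hφ]
        simp only
        have h4 : ρ (Set.Ici t) ^ θ ≠ 0 := by
          simp [ENNReal.rpow_eq_zero_iff, hIci t ht.2, measure_ne_top]
        have h5 : ρ (Set.Ici t) ^ θ ≠ ⊤ :=
          ENNReal.rpow_ne_top_of_nonneg hθ0.le (measure_ne_top _ _)
        rw [← ENNReal.mul_inv_cancel h4 h5]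
        exact mul_le_mul_left h3 _
      _ = decayConst n r * ∫⁻ t in Set.Ioc 0 s, φ t ∂(volume.withDensity (β.rnDeriv volume)) := by
        rw [lintegral_const_mul' _ _ (decayConst_ne_top n hr hrk),
          restrict_withDensity measurableSet_Ioc,
          lintegral_withDensity_eq_lintegral_mul _ (Measure.measurable_rnDeriv _ _) hφm]
        rfl
      _ ≤ decayConst n r * ∫⁻ t in Set.Ioc 0 s, φ t ∂β :=
        mul_le_mul_right (lintegral_mono' (Measure.restrict_mono le_rfl
          (Measure.withDensity_rnDeriv_le _ _)) le_rfl) _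
  refine step1.trans (mul_le_mul_right ?_ _)
  have hHm : Measurable fun y => ENNReal.ofReal |meanCurv v y| ^ r :=
    (measurable_meanCurv v).abs.ennreal_ofReal.pow_const _
  have hgm : Measurable fun y => ENNReal.ofReal ‖gradient v y‖ :=
    (continuous_gradient hv1).measurable.norm.ennreal_ofReal
  rw [lintegral_levelMass hv1 hHm hφm measurableSet_Ioc]
  have hconj : p.HolderConjugate (p / (p - 1)) := Real.HolderConjugate.conjExponent hp
  refine (ENNReal.lintegral_mul_le_Lp_mul_Lq _ hconj (hHm.mul hgm).aemeasurable
    (hφm.comp hva).aemeasurable).trans ?_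
  refine mul_le_mul' (ENNReal.rpow_le_rpow (lintegral_mono' (Measure.restrict_mono
    Set.inter_subset_right le_rfl) le_rfl) (by positivity))
    (ENNReal.rpow_le_rpow ?_ (by positivity))
  have hlog := lintegral_inv_measure_Ici_le ρ (s := s) (by rwa [measureReal_def, hρs])
  rw [measureReal_def, measureReal_def, hρs, hρuniv] at hlog
  refine le_trans ?_ hlog
  rw [hρ, setLIntegral_map measurableSet_Iic _ hva, Measure.restrict_restrict
    (hva measurableSet_Iic), ← hρ]
  · have hsub : {y | |v y| ∈ Set.Ioc 0 s} ∩ Ω ⊆ (fun y => |v y|) ⁻¹' Set.Iic s ∩ Ω :=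
      fun y hy => ⟨hy.1.2, hy.2⟩
    refine lintegral_mono' (Measure.restrict_mono hsub le_rfl) fun y => ?_
    simp only [hφ, Function.comp_apply]
    rw [ENNReal.inv_rpow, ← ENNReal.rpow_mul, hθp, ENNReal.rpow_one]
  · exact (antitone_measure_Ici _).measurable.inv

theorem lintegral_rpow_eq {Ω : Set (𝔼 n)} {p r Ip : ℝ} (hp : 1 < p) (hr : 1 ≤ r)
    {v : (𝔼 n) → ℝ} (hv : ContDiff ℝ 1 v)
    (hIp : Ip = (∫ x in Ω ∩ {x | gradient v x ≠ 0},
      |meanCurv v x| ^ (p * r) * ‖gradient v x‖ ^ p) ^ (1 / p)) (hIp0 : 0 < Ip) :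
    ∫⁻ y in Ω, (ENNReal.ofReal |meanCurv v y| ^ r * ENNReal.ofReal ‖gradient v y‖) ^ p =
      ENNReal.ofReal Ip ^ p := by
  have hp0 : 0 < p := by linarith
  have hG : MeasurableSet {x | gradient v x ≠ 0} :=
    ((continuous_gradient hv).measurable (measurableSet_singleton 0)).compl
  have hint : IntegrableOn (fun x => |meanCurv v x| ^ (p * r) * ‖gradient v x‖ ^ p)
      (Ω ∩ {x | gradient v x ≠ 0}) := by
    by_contra h
    rw [integral_undef h, Real.zero_rpow (by positivity)] at hIp
    exact hIp0.ne' hIp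
  have hnn : ∀ x, 0 ≤ |meanCurv v x| ^ (p * r) * ‖gradient v x‖ ^ p := fun x => by positivity
  have hpow : Ip ^ p = ∫ x in Ω ∩ {x | gradient v x ≠ 0},
      |meanCurv v x| ^ (p * r) * ‖gradient v x‖ ^ p := by
    rw [hIp, one_div, Real.rpow_inv_rpow (integral_nonneg hnn) hp0.ne']
  rw [ENNReal.ofReal_rpow_of_pos hIp0, hpow,
    ofReal_integral_eq_lintegral_ofReal hint (.of_forall hnn), Set.inter_comm,
    ← Measure.restrict_restrict hG, ← lintegral_indicator hG]
  refine lintegral_congr fun y => ?_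
  by_cases hy : gradient v y = 0
  · simp [hy, hp0]
  · rw [Set.indicator_of_mem (by exact hy), ENNReal.ofReal_mul (by positivity),
      ENNReal.mul_rpow_of_nonneg _ _ hp0.le, ← ENNReal.rpow_mul, mul_comm r p,
      ENNReal.ofReal_rpow_of_nonneg (abs_nonneg _) (by positivity),
      ENNReal.ofReal_rpow_of_nonneg (norm_nonneg _) hp0.le]

end Decay

/-- Exponential decay of the distribution function in the critical case `n = p(1+r)`
(inequality (3.7)): `V(s) ≤ |Ω| exp(-(s/(A I_p))^{p'})` for a.e. `s ∈ (0, ‖v‖_{L^∞(Ω)})`. -/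
theorem stmt_5 (n : ℕ) (hn : 2 ≤ n) (p r : ℝ) (hp : 1 < p) (hr : 1 ≤ r)
    (hnpr : (n : ℝ) = p * (1 + r)) :
    ∃ A : ℝ, 0 < A ∧
      ∀ (Ω : Set (EuclideanSpace ℝ (Fin n))), IsOpen Ω → IsBounded Ω →
        ∀ v : EuclideanSpace ℝ (Fin n) → ℝ, ContDiff ℝ (⊤ : ℕ∞) v →
          (∀ x ∈ frontier Ω, v x = 0) →
          ∀ Ip : ℝ,
            Ip = (∫ x in Ω ∩ {x | gradient v x ≠ 0},
                |meanCurv v x| ^ (p * r) * ‖gradient v x‖ ^ p) ^ (1 / p) →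
            0 < Ip →
            ∀ᵐ s ∂(volume.restrict (Set.Ioo 0 ((eLpNorm v ⊤ (volume.restrict Ω)).toReal))),
              (volume (Ω ∩ {x | s < |v x|})).toReal ≤
                (volume Ω).toReal * Real.exp (-(s / (A * Ip)) ^ (p / (p - 1))) := by
  have hn2 : 2 < n := by
    have : (2 : ℝ) < n := by rw [hnpr]; nlinarith
    exact_mod_cast this
  have hp1 : 0 < p - 1 := by linarith
  have hq : 0 < p / (p - 1) := by positivity
  have hrk : r < (n : ℝ) - 1 := by rw [hnpr]; nlinarith
  refine ⟨(decayConst n r).toReal + 1, by positivity, ?_⟩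
  intro Ω hΩ hb v hv hv0 Ip hIp hIp0
  refine (ae_restrict_iff' measurableSet_Ioo).2 (.of_forall fun s hs => ?_)
  set A := (decayConst n r).toReal + 1 with hA
  have hA0 : 0 < A := by positivity
  have hv2 : ContDiff ℝ 2 v := hv.of_le (WithTop.coe_le_coe.2 (le_top (a := (2 : ℕ∞))))
  have hK := lintegral_rpow_eq hp hr (hv2.of_le one_le_two) hIp hIp0
  rcases (measureReal_nonneg (μ := volume) (s := Ω ∩ {x | s < |v x|})).eq_or_lt with hV | hV
  · rw [← measureReal_def, ← hV]
    positivity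
  have main := ofReal_le_decay hn2 hp hr hnpr hΩ hb hv2 hv0
    (by rw [hK]; exact ENNReal.rpow_ne_top_of_nonneg (by linarith) ENNReal.ofReal_ne_top) hV
  rw [← measureReal_def, ← measureReal_def]
  have hle : volume.real (Ω ∩ {x | s < |v x|}) ≤ volume.real Ω :=
    measureReal_mono Set.inter_subset_left hb.measure_lt_top.ne
  set V := volume.real (Ω ∩ {x | s < |v x|})
  set T := volume.real Ω
  have hT : 0 < T := hV.trans_le hle
  have hL : 0 ≤ Real.log (T / V) := Real.log_nonneg ((one_le_div hV).2 hle)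
  rw [hK, one_div, ENNReal.rpow_rpow_inv (by linarith),
    ENNReal.ofReal_rpow_of_nonneg hL (by positivity), ← ENNReal.ofReal_mul hIp0.le,
    ← ENNReal.ofReal_toReal (decayConst_ne_top n hr hrk), ← ENNReal.ofReal_mul (by positivity),
    ENNReal.ofReal_le_ofReal_iff (by positivity)] at main
  have h1 : s / (A * Ip) ≤ Real.log (T / V) ^ (1 / (p / (p - 1))) := by
    rw [div_le_iff₀ (by positivity)]
    refine main.trans ?_
    rw [← mul_assoc, mul_comm]
    refine mul_le_mul_of_nonneg_left ?_ (by positivity)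
    exact mul_le_mul_of_nonneg_right (by linarith) hIp0.le
  have h2 : (s / (A * Ip)) ^ (p / (p - 1)) ≤ Real.log (T / V) := by
    have h0 : 0 ≤ s / (A * Ip) := div_nonneg hs.1.le (by positivity)
    refine (Real.rpow_le_rpow h0 h1 hq.le).trans_eq ?_
    rw [one_div, Real.rpow_inv_rpow hL hq.ne']
  have h3 : V / T ≤ Real.exp (-(s / (A * Ip)) ^ (p / (p - 1))) := by
    rw [← Real.log_le_iff_le_exp (by positivity), Real.log_div hV.ne' hT.ne']
    rw [Real.log_div hT.ne' hV.ne'] at h2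
    linarith
  rw [div_le_iff₀ hT] at h3
  linarith
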